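/- arXiv:2110.14912 — 2 statements merged into one kernel-verified Lean document; each statement's English description precedes it below -/
import Mathlib

section
/- For every T ∈ (0, ∞) there exists a constant C_T > 0 such that for every real M ≥ 1 and all Schwartz-regular solutions u, v of the linear equation i ∂ₜw − Δw + |x|² w = 0 one has ∫₀^T ∫∫_{ {(x,y) ∈ ℝ²×ℝ² : |x−y| < 1/M} } M · | u(t,x) ∇_y conj(v(t,y)) + conj(v(t,y)) ∇_x u(t,x) |² dx dy dt ≤ C_T ( ‖v(0)‖²_{L²} ‖u(0)‖_{L²} ‖u(0)‖_{ℋ¹} + ‖u(0)‖²_{L²} ‖v(0)‖_{L²} ‖v(0)‖_{ℋ¹} ), where | · | denotes the Euclidean norm of a vector in ℂ². -/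
open MeasureTheory Complex

noncomputable section

abbrev E2 : Type := EuclideanSpace ℝ (Fin 2)

/-- Partial derivative in the `i`-th coordinate direction. -/
noncomputable def pd (i : Fin 2) (f : E2 → ℂ) : E2 → ℂ :=
  fun x => fderiv ℝ f x (EuclideanSpace.single i 1)

/-- The Laplacian on `ℝ²`. -/
noncomputable def lap (f : E2 → ℂ) : E2 → ℂ :=
  fun x => ∑ i : Fin 2, pd i (pd i f) x

/-- The harmonic oscillator `A f = -Δ f + |x|² f`. -/
noncomputable def Aop (f : E2 → ℂ) : E2 → ℂ :=
  fun x => -lap f x + (‖x‖ : ℂ)^2 * f x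

/-- Time derivative of a time-dependent function. -/
noncomputable def tderiv (F : ℝ → E2 → ℂ) : ℝ → E2 → ℂ :=
  fun t x => deriv (fun s => F s x) t

/-- Squared euclidean norm of the gradient, `|∇f|²(x)`. -/
noncomputable def gradSq (f : E2 → ℂ) (x : E2) : ℝ := ∑ i : Fin 2, ‖pd i f x‖^2

/-- The `L²` norm. -/
noncomputable def L2norm (f : E2 → ℂ) : ℝ := Real.sqrt (∫ x : E2, ‖f x‖^2)

/-- The `ℋ¹` norm: `(‖∇φ‖² + ‖|x|φ‖²)^(1/2)`. -/
noncomputable def H1norm (f : E2 → ℂ) : ℝ :=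
  Real.sqrt ((∫ x : E2, gradSq f x) + ∫ x : E2, ‖x‖^2 * ‖f x‖^2)

/-- A Schwartz-regular solution of the cubic NLS with harmonic potential,
`i ∂ₜ u - Δu + |x|² u + σ u |u|² = 0`. -/
def IsSolution (σ : ℝ) (u : ℝ → SchwartzMap E2 ℂ) : Prop :=
  ContDiff ℝ (⊤ : ℕ∞) (fun p : ℝ × E2 => u p.1 p.2) ∧
  ∀ (t : ℝ) (x : E2), Complex.I * deriv (fun s => u s x) t - lap (fun y => u t y) x
    + (‖x‖ : ℂ)^2 * u t x + (σ : ℂ) * u t x * (‖u t x‖ : ℂ)^2 = 0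

/-- A Schwartz-regular solution of the linear Schrödinger equation with harmonic
potential, `i ∂ₜ w - Δw + |x|² w = 0`. -/
def IsLinSolution (w : ℝ → SchwartzMap E2 ℂ) : Prop :=
  ContDiff ℝ (⊤ : ℕ∞) (fun p : ℝ × E2 => w p.1 p.2) ∧
  ∀ (t : ℝ) (x : E2), Complex.I * deriv (fun s => w s x) t - lap (fun y => w t y) x
    + (‖x‖ : ℂ)^2 * w t x = 0

/-- Partial derivative for real-valued functions. -/
noncomputable def pdR (i : Fin 2) (f : E2 → ℝ) : E2 → ℝ :=
  fun x => fderiv ℝ f x (EuclideanSpace.single i 1)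

/-- The Laplacian for real-valued functions. -/
noncomputable def lapR (f : E2 → ℝ) : E2 → ℝ :=
  fun x => ∑ i : Fin 2, pdR i (pdR i f) x

section VirialProof

open SchwartzMap LineDeriv Laplacian
open scoped ComplexConjugate
open Set Filter Topology

/-- The coordinate vectors of `ℝ²`. -/
abbrev coordVec (i : Fin 2) : E2 := EuclideanSpace.single i 1

theorem pd_eq_lineDerivOp (i : Fin 2) (f : 𝓢(E2, ℂ)) : pd i f = ⇑(∂_{coordVec i} f : 𝓢(E2, ℂ)) := rfl

theorem lap_eq_laplacian (f : 𝓢(E2, ℂ)) : lap f = ⇑(Δ f : 𝓢(E2, ℂ)) := by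
  ext x
  rw [laplacian_eq_sum (EuclideanSpace.basisFun (Fin 2) ℝ)]
  simp [lap, pd_eq_lineDerivOp]

theorem hasTemperateGrowth_norm_sq_complex :
    (fun x : E2 => (‖x‖ : ℂ) ^ 2).HasTemperateGrowth := by
  have := Function.Complex.hasTemperateGrowth_ofReal.comp
    (Function.hasTemperateGrowth_norm_sq E2)
  simpa [Function.comp_def] using this

/-- The harmonic oscillator on Schwartz functions. -/
def harm (f : 𝓢(E2, ℂ)) : 𝓢(E2, ℂ) :=
  -(Δ f) + smulLeftCLM ℂ (fun x : E2 => (‖x‖ : ℂ) ^ 2) f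

theorem harm_apply (f : 𝓢(E2, ℂ)) (x : E2) :
    harm f x = -lap f x + (‖x‖ : ℂ) ^ 2 * f x := by
  simp [harm, lap_eq_laplacian, smulLeftCLM_apply_apply hasTemperateGrowth_norm_sq_complex]

/-- Complex conjugation on Schwartz functions. -/
def conjS {V : Type*} [NormedAddCommGroup V] [NormedSpace ℝ V] (f : 𝓢(V, ℂ)) : 𝓢(V, ℂ) :=
  f.postcompCLM (conjCLE : ℂ →L[ℝ] ℂ)

@[simp]
theorem conjS_apply {V : Type*} [NormedAddCommGroup V] [NormedSpace ℝ V] (f : 𝓢(V, ℂ)) (x : V) :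
    conjS f x = conj (f x) := by
  simp [conjS]

theorem lineDerivOp_conjS {V : Type*} [NormedAddCommGroup V] [NormedSpace ℝ V]
    (f : 𝓢(V, ℂ)) (v : V) : ∂_{v} (conjS f) = conjS (∂_{v} f) := by
  ext x
  rw [lineDerivOp_apply_eq_fderiv, conjS_apply, lineDerivOp_apply_eq_fderiv]
  have h : ⇑(conjS f) = (conjCLE : ℂ →L[ℝ] ℂ) ∘ f := by ext; simp
  rw [h, ((conjCLE : ℂ →L[ℝ] ℂ).hasFDerivAt.comp x (f.hasFDerivAt x)).fderiv]
  simp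

theorem lap_conjS (f : 𝓢(E2, ℂ)) : Δ (conjS f) = conjS (Δ f) := by
  ext x
  simp [laplacian_eq_sum (EuclideanSpace.basisFun (Fin 2) ℝ), lineDerivOp_conjS]

theorem harm_conjS (f : 𝓢(E2, ℂ)) : harm (conjS f) = conjS (harm f) := by
  ext x
  simp [harm, lap_conjS, smulLeftCLM_apply_apply hasTemperateGrowth_norm_sq_complex]

section Pairing

variable {V : Type*} [NormedAddCommGroup V] [NormedSpace ℝ V] [MeasurableSpace V] [BorelSpace V]
  [FiniteDimensional ℝ V] {μ : Measure V} [μ.IsAddHaarMeasure]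

theorem integrable_mul_schwartz (f g : 𝓢(V, ℂ)) : Integrable (fun x => f x * g x) μ :=
  (pairing (ContinuousLinearMap.mul ℝ ℂ) f g).integrable

theorem integrable_conj_mul (f g : 𝓢(V, ℂ)) : Integrable (fun x => conj (f x) * g x) μ := by
  simpa using integrable_mul_schwartz (μ := μ) (conjS f) g

theorem integrable_norm_sq (f : 𝓢(V, ℂ)) : Integrable (fun x => ‖f x‖ ^ 2) μ := by
  have := (integrable_conj_mul (μ := μ) f f).re
  refine this.congr (Filter.Eventually.of_forall fun x => ?_)
  simp only [RCLike.re_to_complex]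
  rw [← Complex.normSq_eq_conj_mul_self, ofReal_re, normSq_eq_norm_sq]

end Pairing

/-- The `L²` pairing of Schwartz functions, conjugate linear in the first argument. -/
def pair (f g : 𝓢(E2, ℂ)) : ℂ := ∫ x, conj (f x) * g x

theorem integral_mul_harm (f g : 𝓢(E2, ℂ)) :
    ∫ x, f x * harm g x = ∫ x, harm f x * g x := by
  have h := integral_bilinear_laplacian_right_eq_left (μ := volume) f g (ContinuousLinearMap.mul ℝ ℂ)
  simp only [ContinuousLinearMap.mul_apply'] at h
  have e : ∀ a b : 𝓢(E2, ℂ), ∀ x, a x * harm b x = -(a x * (Δ b) x)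
      + a x * (smulLeftCLM ℂ (fun x : E2 => (‖x‖ : ℂ) ^ 2) b) x := by
    intro a b x; simp [harm]; ring
  simp_rw [mul_comm (harm f _), e]
  rw [integral_add (integrable_mul_schwartz _ _).fun_neg (integrable_mul_schwartz _ _),
    integral_add (integrable_mul_schwartz _ _).fun_neg (integrable_mul_schwartz _ _),
    integral_neg, integral_neg, h]
  simp_rw [mul_comm (g _)]
  congr 1
  refine integral_congr_ae (Filter.Eventually.of_forall fun x => ?_)
  simp [smulLeftCLM_apply_apply hasTemperateGrowth_norm_sq_complex]; ring

theorem pair_harm (f g : 𝓢(E2, ℂ)) : pair f (harm g) = pair (harm f) g := by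
  have := integral_mul_harm (conjS f) g
  simpa [pair, harm_conjS] using this

theorem pair_self (f : 𝓢(E2, ℂ)) : pair f f = ((∫ x, ‖f x‖ ^ 2 : ℝ) : ℂ) := by
  rw [pair, ← integral_complex_ofReal]
  congr 1; ext x
  rw [← Complex.normSq_eq_conj_mul_self, normSq_eq_norm_sq]

/-- The square of the `ℋ¹` norm. -/
def energy (f : E2 → ℂ) : ℝ := (∫ x, gradSq f x) + ∫ x, ‖x‖ ^ 2 * ‖f x‖ ^ 2

theorem integrable_gradSq (f : 𝓢(E2, ℂ)) : Integrable (gradSq f) := by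
  unfold gradSq
  exact integrable_finsetSum _ fun i _ => integrable_norm_sq (∂_{coordVec i} f)

theorem integrable_norm_sq_mul_norm_sq (f : 𝓢(E2, ℂ)) :
    Integrable (fun x : E2 => ‖x‖ ^ 2 * ‖f x‖ ^ 2) := by
  have := (integrable_conj_mul (μ := volume) f (smulLeftCLM ℂ (fun x : E2 => (‖x‖ : ℂ) ^ 2) f)).re
  refine this.congr (Filter.Eventually.of_forall fun x => ?_)
  simp only [RCLike.re_to_complex, smulLeftCLM_apply_apply hasTemperateGrowth_norm_sq_complex]
  rw [smul_eq_mul, mul_left_comm, ← Complex.normSq_eq_conj_mul_self, normSq_eq_norm_sq]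
  norm_cast

theorem pair_harm_self (f : 𝓢(E2, ℂ)) : pair f (harm f) = (energy f : ℂ) := by
  have e : ∀ x, conj (f x) * harm f x = -(∑ i, conj (f x) * (∂_{coordVec i} (∂_{coordVec i} f)) x)
      + ((‖x‖ ^ 2 * ‖f x‖ ^ 2 : ℝ) : ℂ) := by
    intro x
    rw [harm_apply, mul_add, mul_left_comm (conj (f x)), ← Complex.normSq_eq_conj_mul_self,
      normSq_eq_norm_sq, ← Finset.mul_sum]
    push_cast
    simp [lap, pd_eq_lineDerivOp]
    ring
  have hr : Integrable (fun x : E2 => ((‖x‖ ^ 2 * ‖f x‖ ^ 2 : ℝ) : ℂ)) :=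
    (integrable_norm_sq_mul_norm_sq f).ofReal
  have h : ∀ i, ∫ x, conj (f x) * (∂_{coordVec i} (∂_{coordVec i} f)) x
      = -((∫ x, ‖pd i f x‖ ^ 2 : ℝ) : ℂ) := by
    intro i
    have := integral_mul_lineDerivOp_right_eq_neg_left (μ := volume) (conjS f) (∂_{coordVec i} f)
      (coordVec i)
    rw [lineDerivOp_conjS] at this
    simp only [conjS_apply] at this
    rw [this, pd_eq_lineDerivOp, ← pair_self, pair]
  have hi : ∀ i ∈ Finset.univ, Integrable
      (fun x => conj (f x) * (∂_{coordVec i} (∂_{coordVec i} f)) x) :=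
    fun i _ => integrable_conj_mul _ _
  unfold pair energy gradSq
  simp_rw [e]
  rw [integral_add (integrable_finsetSum _ hi).fun_neg hr,
    integral_neg, integral_finsetSum _ hi, integral_finsetSum _
      fun i _ => (show Integrable fun x => ‖pd i f x‖ ^ 2 from integrable_norm_sq (∂_{coordVec i} f))]
  simp_rw [h]
  rw [integral_complex_ofReal]
  simp

/-- The fundamental theorem of calculus for a parameter integral whose derivative is bounded in
`L¹`, uniformly in the parameter. -/
theorem integral_sub_eq_of_hasDerivAt {V : Type*} [NormedAddCommGroup V] [NormedSpace ℝ V]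
    [MeasurableSpace V] [BorelSpace V] [FiniteDimensional ℝ V] {μ : Measure V} [SFinite μ]
    {P P' : ℝ → V → ℂ} {a b K : ℝ} (hab : a ≤ b)
    (hcont : Continuous (Function.uncurry P'))
    (hderiv : ∀ t x, HasDerivAt (fun s => P s x) (P' t x) t)
    (hP : ∀ t, Integrable (P t) μ) (hP' : ∀ t, Integrable (P' t) μ)
    (hK : ∀ t ∈ Icc a b, ∫ x, ‖P' t x‖ ∂μ ≤ K) :
    IntervalIntegrable (fun t => ∫ x, P' t x ∂μ) volume a b ∧
      ∫ t in a..b, ∫ x, P' t x ∂μ = (∫ x, P b x ∂μ) - ∫ x, P a x ∂μ := by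
  have hm : AEStronglyMeasurable (Function.uncurry P') ((volume.restrict (Ioc a b)).prod μ) :=
    hcont.aestronglyMeasurable
  have hint : Integrable (Function.uncurry P') ((volume.restrict (Ioc a b)).prod μ) := by
    rw [integrable_prod_iff hm]
    refine ⟨Eventually.of_forall hP', ?_⟩
    refine Integrable.of_bound hm.norm.integral_prod_right' K ?_
    filter_upwards [ae_restrict_mem measurableSet_Ioc] with t ht
    rw [Real.norm_of_nonneg (integral_nonneg fun _ => norm_nonneg _)]
    exact hK t (Ioc_subset_Icc_self ht)
  refine ⟨?_, ?_⟩
  · rw [intervalIntegrable_iff_integrableOn_Ioc_of_le hab]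
    exact hint.integral_prod_left
  · rw [intervalIntegral.integral_of_le hab, integral_integral_swap hint, ← integral_sub (hP b) (hP a)]
    congr 1; ext x
    rw [← intervalIntegral.integral_of_le hab]
    refine intervalIntegral.integral_eq_sub_of_hasDerivAt (fun t _ => hderiv t x) ?_
    exact (hcont.comp (by fun_prop : Continuous fun t : ℝ => (t, x))).intervalIntegrable _ _

/-- Local boundedness from above. -/
def LocBddAbove (g : ℝ → ℝ) (t : ℝ) : Prop := ∃ K, ∀ᶠ s in 𝓝 t, g s ≤ K

theorem LocBddAbove.comp_neg {g : ℝ → ℝ} {t : ℝ} (h : LocBddAbove g t) :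
    LocBddAbove (fun s => g (-s)) (-t) := by
  obtain ⟨K, hK⟩ := h
  refine ⟨K, ?_⟩
  have : Tendsto (fun s : ℝ => -s) (𝓝 (-t)) (𝓝 t) := by
    simpa using (continuous_neg (G := ℝ)).tendsto (-t)
  exact this.eventually hK

theorem isClosed_not_locBddAbove (g : ℝ → ℝ) : IsClosed {t | ¬ LocBddAbove g t} := by
  rw [← isOpen_compl_iff, isOpen_iff_mem_nhds]
  intro t ht
  obtain ⟨K, hK⟩ := not_not.mp ht
  filter_upwards [hK.eventually_nhds] with s hs
  exact not_not.mpr ⟨K, hs⟩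

theorem bddAbove_of_locBddAbove {g : ℝ → ℝ} {S : Set ℝ} (hS : IsCompact S)
    (h : ∀ t ∈ S, LocBddAbove g t) : ∃ K, ∀ t ∈ S, g t ≤ K := by
  refine hS.induction_on (p := fun S => ∃ K, ∀ t ∈ S, g t ≤ K) ⟨0, by simp⟩ ?_ ?_ ?_
  · rintro s t hst ⟨K, hK⟩
    exact ⟨K, fun x hx => hK x (hst hx)⟩
  · rintro s t ⟨K, hK⟩ ⟨L, hL⟩
    refine ⟨max K L, ?_⟩
    rintro x (hx | hx)
    · exact (hK x hx).trans (le_max_left _ _)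
    · exact (hL x hx).trans (le_max_right _ _)
  · intro x hx
    obtain ⟨K, hK⟩ := h x hx
    exact ⟨{s | g s ≤ K}, mem_nhdsWithin_of_mem_nhds hK, K, fun _ h => h⟩

/-- `g` is constant on every nondegenerate compact interval on which it is bounded above. -/
def ConstOnBdd (g : ℝ → ℝ) : Prop :=
  ∀ a b K, a < b → (∀ t ∈ Icc a b, g t ≤ K) → ∀ s ∈ Icc a b, ∀ t ∈ Icc a b, g s = g t

theorem ConstOnBdd.comp_neg {g : ℝ → ℝ} (h : ConstOnBdd g) : ConstOnBdd (fun s => g (-s)) := by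
  intro a b K hab hK s hs t ht
  refine h (-b) (-a) K (by linarith) (fun r hr => ?_) (-s) ?_ (-t) ?_
  · have := hK (-r) ⟨by linarith [hr.2], by linarith [hr.1]⟩
    simpa using this
  · exact ⟨by linarith [hs.2], by linarith [hs.1]⟩
  · exact ⟨by linarith [ht.2], by linarith [ht.1]⟩

theorem ConstOnBdd.exists_left {g : ℝ → ℝ} (h : ConstOnBdd g) {p t : ℝ} (hpt : p < t)
    (hp : ¬ LocBddAbove g p) (ht : LocBddAbove g t) :
    ∃ a ∈ Ico p t, ¬ LocBddAbove g a ∧ g a = g t := by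
  set S := Icc p t ∩ {t | ¬ LocBddAbove g t} with hS
  have hSc : IsCompact S := isCompact_Icc.inter_right (isClosed_not_locBddAbove g)
  obtain ⟨a, haS, ha⟩ := hSc.exists_isGreatest ⟨p, ⟨le_rfl, hpt.le⟩, hp⟩
  have hat : a < t := lt_of_le_of_ne haS.1.2 (by rintro rfl; exact haS.2 ht)
  refine ⟨a, ⟨haS.1.1, hat⟩, haS.2, ?_⟩
  have hloc : ∀ c ∈ Ioc a t, LocBddAbove g c := by
    intro c hc
    by_contra hcon
    exact absurd (ha ⟨⟨haS.1.1.trans hc.1.le, hc.2⟩, hcon⟩) (not_le.mpr hc.1)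
  have hconst : ∀ c ∈ Ioc a t, g c = g t := by
    intro c hc
    rcases hc.2.eq_or_lt with rfl | hct
    · rfl
    obtain ⟨K, hK⟩ := bddAbove_of_locBddAbove (isCompact_Icc (a := c) (b := t))
      fun s hs => hloc s ⟨hc.1.trans_le hs.1, hs.2⟩
    exact h c t K hct hK c ⟨le_rfl, hct.le⟩ t ⟨hct.le, le_rfl⟩
  refine h a t (max (g a) (g t)) hat (fun s hs => ?_) a ⟨le_rfl, hat.le⟩ t ⟨hat.le, le_rfl⟩
  rcases hs.1.eq_or_lt with rfl | has
  · exact le_max_left _ _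
  · exact (hconst s ⟨has, hs.2⟩).le.trans (le_max_right _ _)

/-- A function with closed sublevel sets which is constant on every compact interval on which it
is bounded is constant. -/
theorem ConstOnBdd.const {g : ℝ → ℝ} (h : ConstOnBdd g) (hc : ∀ K, IsClosed {t | g t ≤ K})
    (s t : ℝ) : g s = g t := by
  have hloc : ∀ t, LocBddAbove g t := by
    by_contra hne
    push Not at hne
    obtain ⟨p, hp⟩ := hne
    set F := {t | ¬ LocBddAbove g t} with hF
    have hFc : IsClosed F := isClosed_not_locBddAbove g
    have : CompleteSpace F := hFc.completeSpace_coe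
    have : Nonempty F := ⟨⟨p, hp⟩⟩
    obtain ⟨n, ⟨q, hq⟩, hqn⟩ := nonempty_interior_of_iUnion_of_closed
      (f := fun n : ℕ => {t : F | g t ≤ n}) (fun n => (hc n).preimage continuous_subtype_val)
      (by
        rw [eq_univ_iff_forall]
        intro t
        obtain ⟨n, hn⟩ := exists_nat_ge (g t)
        exact mem_iUnion.mpr ⟨n, hn⟩)
    rw [mem_interior_iff_mem_nhds, Metric.mem_nhds_iff] at hqn
    obtain ⟨ε, hε, hball⟩ := hqn
    have hb : ∀ t ∈ F, |t - q| < ε → g t ≤ n := fun t ht htq =>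
      hball (show (⟨t, ht⟩ : F) ∈ Metric.ball _ ε from htq)
    refine hq ⟨n, ?_⟩
    filter_upwards [Metric.ball_mem_nhds q hε] with t htq
    rw [Metric.mem_ball, Real.dist_eq] at htq
    by_cases htF : LocBddAbove g t
    · rcases lt_trichotomy q t with hqt | rfl | hqt
      · obtain ⟨a, ha, haF, hat⟩ := h.exists_left hqt hq htF
        rw [← hat]
        refine hb a haF (lt_of_le_of_lt ?_ htq)
        rw [abs_of_nonneg (by linarith [ha.1]), abs_of_nonneg (by linarith)]
        linarith [ha.2]
      · exact absurd htF hq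
      · obtain ⟨a, ha, haF, hat⟩ := h.comp_neg.exists_left (p := -q) (t := -t) (by linarith)
          (fun h' => hq (by simpa using h'.comp_neg)) htF.comp_neg
        simp only [neg_neg] at hat
        rw [← hat]
        refine hb (-a) (fun h' => haF (by simpa using h'.comp_neg)) (lt_of_le_of_lt ?_ htq)
        rw [abs_of_nonpos (by linarith [ha.1]), abs_of_nonpos (by linarith)]
        linarith [ha.2]
    · exact hb t htF htq
  obtain ⟨K, hK⟩ := bddAbove_of_locBddAbove (isCompact_Icc (a := min s t) (b := max s t + 1))
    fun s _ => hloc s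
  have h1 := le_max_left s t
  have h2 := le_max_right s t
  exact h _ _ K (by linarith [min_le_max (a := s) (b := t)]) hK s ⟨min_le_left _ _, by linarith⟩ t
    ⟨min_le_right _ _, by linarith⟩

section JointSmoothness

/-- Joint smoothness in time and space. -/
def JointSmooth (f : ℝ → E2 → ℂ) : Prop := ContDiff ℝ (⊤ : ℕ∞) (fun p : ℝ × E2 => f p.1 p.2)

variable {f : ℝ → E2 → ℂ}

theorem JointSmooth.hasDerivAt_fderiv (hf : JointSmooth f) (t : ℝ) (x : E2) :
    HasDerivAt (fun s => f s x) (fderiv ℝ (fun p : ℝ × E2 => f p.1 p.2) (t, x) (1, 0)) t := by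
  have h := ((hf.differentiable (by simp)) (t, x)).hasFDerivAt
  have h2 : HasDerivAt (fun s : ℝ => (s, x)) ((1 : ℝ), (0 : E2)) t :=
    (hasDerivAt_id t).prodMk (hasDerivAt_const t x)
  exact h.comp_hasDerivAt t h2

theorem JointSmooth.tderiv_eq (hf : JointSmooth f) (t : ℝ) (x : E2) :
    tderiv f t x = fderiv ℝ (fun p : ℝ × E2 => f p.1 p.2) (t, x) (1, 0) :=
  (hf.hasDerivAt_fderiv t x).deriv

theorem JointSmooth.hasDerivAt (hf : JointSmooth f) (t : ℝ) (x : E2) :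
    HasDerivAt (fun s => f s x) (tderiv f t x) t :=
  (hf.hasDerivAt_fderiv t x).differentiableAt.hasDerivAt

theorem JointSmooth.pd_eq (hf : JointSmooth f) (k : Fin 2) (t : ℝ) (x : E2) :
    pd k (f t) x = fderiv ℝ (fun p : ℝ × E2 => f p.1 p.2) (t, x) (0, coordVec k) := by
  have h := ((hf.differentiable (by simp)) (t, x)).hasFDerivAt
  have h2 : HasFDerivAt (fun y : E2 => (t, y)) (ContinuousLinearMap.inr ℝ ℝ E2) x :=
    hasFDerivAt_prodMk_right t x
  have := (h.comp x h2).fderiv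
  unfold pd
  rw [show f t = (fun p : ℝ × E2 => f p.1 p.2) ∘ fun y : E2 => (t, y) from rfl, this]
  simp

theorem contDiff_fderiv_apply_const {V : Type*} [NormedAddCommGroup V] [NormedSpace ℝ V] {W : V → ℂ}
    (hW : ContDiff ℝ (⊤ : ℕ∞) W) (p : V) :
    ContDiff ℝ (⊤ : ℕ∞) (fun z => fderiv ℝ W z p) :=
  (hW.fderiv_right (m := (⊤ : ℕ∞)) (by simp)).clm_apply contDiff_const

theorem fderiv_fderiv_apply_comm {V : Type*} [NormedAddCommGroup V] [NormedSpace ℝ V] {W : V → ℂ}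
    (hW : ContDiff ℝ (⊤ : ℕ∞) W) (p q z : V) :
    fderiv ℝ (fun z => fderiv ℝ W z p) z q = fderiv ℝ (fun z => fderiv ℝ W z q) z p := by
  have hd : DifferentiableAt ℝ (fderiv ℝ W) z :=
    (hW.fderiv_right (m := (⊤ : ℕ∞)) (by simp)).differentiable (by simp) z
  rw [fderiv_clm_apply hd (differentiableAt_const _), fderiv_clm_apply hd (differentiableAt_const _)]
  have := (hW.contDiffAt (x := z)).isSymmSndFDerivAt (by simpa using WithTop.coe_le_coe.mpr (le_top (a := (2 : ℕ∞))))
  simpa using this q p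

theorem JointSmooth.tderiv_comp (hf : JointSmooth f) : JointSmooth (tderiv f) := by
  have := contDiff_fderiv_apply_const hf ((1 : ℝ), (0 : E2))
  unfold JointSmooth
  simp_rw [hf.tderiv_eq]
  exact this

theorem JointSmooth.pd_comp (hf : JointSmooth f) (k : Fin 2) : JointSmooth (fun t => pd k (f t)) := by
  have := contDiff_fderiv_apply_const hf ((0 : ℝ), coordVec k)
  unfold JointSmooth
  simp_rw [hf.pd_eq]
  exact this

theorem JointSmooth.tderiv_pd (hf : JointSmooth f) (k : Fin 2) (t : ℝ) (x : E2) :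
    tderiv (fun t => pd k (f t)) t x = pd k (tderiv f t) x := by
  rw [(hf.pd_comp k).tderiv_eq, hf.tderiv_comp.pd_eq]
  simp_rw [hf.tderiv_eq, hf.pd_eq]
  exact fderiv_fderiv_apply_comm hf _ _ _

end JointSmoothness

theorem pd_const_mul (c : ℂ) (k : Fin 2) (f : 𝓢(E2, ℂ)) (x : E2) :
    pd k (fun y => c * f y) x = c * pd k f x := by
  unfold pd
  rw [fderiv_const_mul (f.differentiableAt)]
  simp

section LinearSolution

variable {w : ℝ → 𝓢(E2, ℂ)} (hw : IsLinSolution w)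

include hw

theorem IsLinSolution.jointSmooth : JointSmooth (fun t => w t) := hw.1

theorem IsLinSolution.tderiv_eq (t : ℝ) (x : E2) :
    tderiv (fun t => w t) t x = I * harm (w t) x := by
  have := hw.2 t x
  have h2 : deriv (fun s => w s x) t = -I * (I * deriv (fun s => w s x) t) := by
    rw [← mul_assoc]; simp
  unfold tderiv
  rw [h2, harm_apply]
  linear_combination (-I) * this

theorem IsLinSolution.hasDerivAt (t : ℝ) (x : E2) :
    HasDerivAt (fun s => w s x) (I * harm (w t) x) t := by
  rw [← hw.tderiv_eq]; exact hw.jointSmooth.hasDerivAt t x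

theorem IsLinSolution.hasDerivAt_pd (k : Fin 2) (t : ℝ) (x : E2) :
    HasDerivAt (fun s => pd k (w s) x) (I * pd k (harm (w t)) x) t := by
  have h := (hw.jointSmooth.pd_comp k).hasDerivAt t x
  rw [hw.jointSmooth.tderiv_pd k t x, show tderiv (fun t => ⇑(w t)) t = fun x => I * harm (w t) x
    from funext (hw.tderiv_eq t), pd_const_mul] at h
  exact h

theorem IsLinSolution.harm_comp : IsLinSolution (fun t => harm (w t)) := by
  have hs : JointSmooth (fun t => harm (w t)) := by
    have e : (fun t => (⇑(harm (w t)) : E2 → ℂ)) =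
        fun t x => -I * tderiv (fun t => w t) t x := by
      ext t x
      rw [hw.tderiv_eq, ← mul_assoc]; simp
    rw [e]
    exact contDiff_const.mul hw.jointSmooth.tderiv_comp
  refine ⟨hs, fun t x => ?_⟩
  have h2 : ∀ k, HasDerivAt (fun s => pd k (pd k (w s)) x) (I * pd k (pd k (harm (w t))) x) t := by
    intro k
    have h := ((hw.jointSmooth.pd_comp k).pd_comp k).hasDerivAt t x
    rw [(hw.jointSmooth.pd_comp k).tderiv_pd k t x, show tderiv (fun t => pd k (w t)) t =
      fun x => I * pd k (harm (w t)) x from funext fun y => (hw.hasDerivAt_pd k t y).deriv] at h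
    have := pd_const_mul I k (∂_{coordVec k} (harm (w t))) x
    rw [← pd_eq_lineDerivOp] at this
    rw [this] at h
    exact h
  have h3 : HasDerivAt (fun s => harm (w s) x) (I * harm (harm (w t)) x) t := by
    simp_rw [harm_apply _ x, lap]
    have := (HasDerivAt.fun_sum (u := Finset.univ) fun k _ => h2 k).fun_neg.fun_add
      ((hw.hasDerivAt t x).const_mul ((‖x‖ : ℂ) ^ 2))
    refine this.congr_deriv ?_
    rw [← Finset.mul_sum, harm_apply _ x, lap]; ring
  rw [h3.deriv, harm_apply _ x, ← mul_assoc, I_mul_I]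
  ring

theorem IsLinSolution.continuous : Continuous (fun p : ℝ × E2 => w p.1 p.2) := hw.1.continuous

theorem IsLinSolution.continuous_pd (k : Fin 2) :
    Continuous (fun p : ℝ × E2 => pd k (w p.1) p.2) :=
  ContDiff.continuous (hw.jointSmooth.pd_comp k)

end LinearSolution

/-- Sublevel sets of the integral of a nonnegative continuous function depending on a parameter
are closed, by Fatou's lemma. -/
theorem isClosed_setOf_integral_le {h : ℝ → E2 → ℝ} (hc : Continuous (Function.uncurry h))
    (h0 : ∀ t x, 0 ≤ h t x) (hi : ∀ t, Integrable (h t)) (K : ℝ) :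
    IsClosed {t | ∫ x, h t x ≤ K} := by
  rcases lt_or_ge K 0 with hK | hK
  · convert isClosed_empty
    rw [eq_empty_iff_forall_notMem]
    intro t ht
    exact absurd (integral_nonneg (h0 t)) (not_le.mpr (lt_of_le_of_lt ht hK))
  have key : ∀ t, ENNReal.ofReal (∫ x, h t x) = ∫⁻ x, ENNReal.ofReal (h t x) := fun t =>
    ofReal_integral_eq_lintegral_ofReal (hi t) (Eventually.of_forall (h0 t))
  have e : {t | ∫ x, h t x ≤ K} = {t | ∫⁻ x, ENNReal.ofReal (h t x) ≤ ENNReal.ofReal K} := by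
    ext t
    rw [mem_ofPred_eq, mem_ofPred_eq, ← key, ENNReal.ofReal_le_ofReal_iff hK]
  rw [e]
  refine IsSeqClosed.isClosed fun s t hs hst => ?_
  have hlim : ∀ x, ENNReal.ofReal (h t x) = liminf (fun n => ENNReal.ofReal (h (s n) x)) atTop := by
    intro x
    refine (Tendsto.liminf_eq ?_).symm
    exact (ENNReal.continuous_ofReal.comp (hc.comp (by fun_prop : Continuous fun r : ℝ => (r, x)))
      |>.tendsto t).comp hst
  simp only [mem_ofPred_eq, hlim] at hs ⊢
  refine (lintegral_liminf_le fun n => ?_).trans ?_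
  · exact (ENNReal.continuous_ofReal.comp (hc.comp
      (by fun_prop : Continuous fun x : E2 => (s n, x)))).measurable
  · refine liminf_le_of_le ?_ fun b hb => ?_
    · isBoundedDefault
    · obtain ⟨n, hn⟩ := hb.exists
      exact hn.trans (hs n)

/-- The squared `L²` norm. -/
def mass (f : E2 → ℂ) : ℝ := ∫ x, ‖f x‖ ^ 2

theorem mass_nonneg (f : E2 → ℂ) : 0 ≤ mass f := integral_nonneg fun _ => by positivity

theorem integral_norm_conj_mul_le (f g : 𝓢(E2, ℂ)) : ∫ x, ‖conj (f x) * g x‖ ≤ mass f + mass g := by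
  unfold mass
  rw [← integral_add (integrable_norm_sq f) (integrable_norm_sq g)]
  refine integral_mono (integrable_conj_mul f g).norm
    ((integrable_norm_sq f).add (integrable_norm_sq g)) fun x => ?_
  simp only [norm_mul, RCLike.norm_conj]
  nlinarith [sq_nonneg (‖f x‖ - ‖g x‖), sq_nonneg (‖f x‖), sq_nonneg (‖g x‖)]

theorem norm_pair_le (f g : 𝓢(E2, ℂ)) : ‖pair f g‖ ≤ mass f + mass g :=
  (norm_integral_le_integral_norm _).trans (integral_norm_conj_mul_le f g)

section Conservation

variable {w : ℝ → 𝓢(E2, ℂ)} (hw : IsLinSolution w) {a b K : ℝ}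
  (hK : ∀ t ∈ Icc a b, mass (w t) + mass (harm (w t)) ≤ K)

include hw hK

theorem IsLinSolution.pair_shift {t₁ t₂ r : ℝ} (hr : 0 ≤ r) (h₁ : t₁ ∈ Icc a b) (h₂ : t₂ ∈ Icc a b)
    (h₁' : t₁ + r ∈ Icc a b) (h₂' : t₂ + r ∈ Icc a b) :
    pair (w (t₁ + r)) (w (t₂ + r)) = pair (w t₁) (w t₂) := by
  set P' : ℝ → E2 → ℂ := fun s x => conj (I * harm (w (t₁ + s)) x) * w (t₂ + s) x +
    conj (w (t₁ + s) x) * (I * harm (w (t₂ + s)) x) with hP'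
  have hP'e : ∀ s, P' s = fun x => -I * (conj (harm (w (t₁ + s)) x) * w (t₂ + s) x) +
      I * (conj (w (t₁ + s) x) * harm (w (t₂ + s)) x) := by
    intro s; ext x; simp [hP']; ring
  have i₁ := fun s => integrable_conj_mul (μ := volume) (harm (w (t₁ + s))) (w (t₂ + s))
  have i₂ := fun s => integrable_conj_mul (μ := volume) (w (t₁ + s)) (harm (w (t₂ + s)))
  have hint : ∀ s, Integrable (P' s) := fun s => by
    rw [hP'e]; exact ((i₁ s).const_mul _).add ((i₂ s).const_mul _)
  have hzero : ∀ s, ∫ x, P' s x = 0 := by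
    intro s
    rw [hP'e, integral_add ((i₁ s).const_mul _) ((i₂ s).const_mul _), integral_const_mul,
      integral_const_mul]
    have := pair_harm (w (t₁ + s)) (w (t₂ + s))
    unfold pair at this
    rw [this]; ring
  have hsh : ∀ c : ℝ, Continuous (fun p : ℝ × E2 => (c + p.1, p.2)) := fun c => by fun_prop
  have hcw := fun c => hw.continuous.comp (hsh c)
  have hch := fun c => hw.harm_comp.continuous.comp (hsh c)
  have hcont : Continuous (Function.uncurry P') := by
    have h₁ := hch t₁
    have h₂ := hch t₂
    have h₃ := hcw t₁
    have h₄ := hcw t₂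
    simp only [Function.comp_def] at h₁ h₂ h₃ h₄
    simp only [hP', Function.uncurry_def]
    exact ((continuous_conj.comp (continuous_const.fun_mul h₁)).fun_mul h₄).fun_add
      ((continuous_conj.comp h₃).fun_mul (continuous_const.fun_mul h₂))
  have hd : ∀ (t c : ℝ) (x : E2), HasDerivAt (fun s => w (c + s) x) (I * harm (w (c + t)) x) t :=
    fun t c x => (hw.hasDerivAt (c + t) x).comp_const_add c t
  have hderiv : ∀ t x, HasDerivAt (fun s => conj (w (t₁ + s) x) * w (t₂ + s) x) (P' t x) t := by
    intro t x
    exact (HasDerivAt.star (hd t t₁ x)).mul (hd t t₂ x)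
  have hbound : ∀ s ∈ Icc 0 r, ∫ x, ‖P' s x‖ ≤ K + K := by
    intro s hs
    have k₁ := hK (t₁ + s) ⟨by linarith [h₁.1, hs.1], by linarith [h₁'.2, hs.2]⟩
    have k₂ := hK (t₂ + s) ⟨by linarith [h₂.1, hs.1], by linarith [h₂'.2, hs.2]⟩
    calc ∫ x, ‖P' s x‖ ≤ ∫ x, (‖conj (harm (w (t₁ + s)) x) * w (t₂ + s) x‖ +
          ‖conj (w (t₁ + s) x) * harm (w (t₂ + s)) x‖) := by
          refine integral_mono (hint s).norm ((i₁ s).norm.add (i₂ s).norm) fun x => ?_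
          simp only [hP'e]
          refine (norm_add_le _ _).trans (le_of_eq ?_)
          simp
      _ ≤ _ := by
          rw [integral_add (i₁ s).norm (i₂ s).norm]
          linarith [integral_norm_conj_mul_le (harm (w (t₁ + s))) (w (t₂ + s)),
            integral_norm_conj_mul_le (w (t₁ + s)) (harm (w (t₂ + s)))]
  have := (integral_sub_eq_of_hasDerivAt hr hcont hderiv (fun t => integrable_conj_mul _ _) hint
    hbound).2
  simp only [hzero, intervalIntegral.integral_zero, add_zero] at this
  exact (sub_eq_zero.mp this.symm)

theorem IsLinSolution.integral_pair (φ : 𝓢(E2, ℂ)) {s t : ℝ} (hst : s ≤ t) (hs : s ∈ Icc a b)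
    (ht : t ∈ Icc a b) :
    IntervalIntegrable (fun r => I * pair (harm φ) (w r)) volume s t ∧
    ∫ r in s..t, I * pair (harm φ) (w r) = pair φ (w t) - pair φ (w s) := by
  have e : ∀ r, I * pair (harm φ) (w r) = ∫ x, conj (φ x) * (I * harm (w r) x) := by
    intro r
    rw [← pair_harm, pair, ← integral_const_mul]
    congr 1; ext x; ring
  have hi : ∀ r, Integrable (fun x => conj (φ x) * (I * harm (w r) x)) := fun r => by
    simp_rw [mul_left_comm]
    exact (integrable_conj_mul φ (harm (w r))).const_mul I
  simp_rw [e]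
  refine integral_sub_eq_of_hasDerivAt (P := fun r x => conj (φ x) * w r x)
    (K := mass φ + K) hst ?_ ?_ (fun r => integrable_conj_mul _ _) hi ?_
  · exact (continuous_conj.comp (φ.continuous.comp continuous_snd)).mul
      (continuous_const.mul hw.harm_comp.continuous)
  · exact fun r x => (hw.hasDerivAt r x).const_mul _
  · intro r hr
    have h := integral_norm_conj_mul_le φ (harm (w r))
    have k := hK r ⟨hs.1.trans hr.1, hr.2.trans ht.2⟩
    simp only [norm_mul, norm_I, one_mul] at h ⊢
    linarith [mass_nonneg (w r)]

theorem IsLinSolution.continuousOn_pair (φ : 𝓢(E2, ℂ)) :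
    ContinuousOn (fun s => pair φ (w s)) (Icc a b) := by
  set L := mass (harm φ) + K with hL
  have hmono : ∀ s ∈ Icc a b, ∀ t ∈ Icc a b, s ≤ t →
      ‖pair φ (w s) - pair φ (w t)‖ ≤ |L| * |s - t| := by
    intro s hs t ht hst
    rw [norm_sub_rev, ← (hw.integral_pair hK φ hst hs ht).2, abs_sub_comm s t]
    refine intervalIntegral.norm_integral_le_of_norm_le_const fun r hr => ?_
    rw [uIoc_of_le hst] at hr
    have := norm_pair_le (harm φ) (w r)
    have k := hK r ⟨hs.1.trans hr.1.le, hr.2.trans ht.2⟩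
    rw [norm_mul, norm_I, one_mul]
    refine le_trans ?_ (le_abs_self L)
    linarith [mass_nonneg (harm (w r))]
  have hlip : LipschitzOnWith (Real.toNNReal |L|) (fun s => pair φ (w s)) (Icc a b) := by
    refine LipschitzOnWith.of_dist_le_mul fun s hs t ht => ?_
    rw [Real.coe_toNNReal _ (abs_nonneg _), dist_eq_norm, Real.dist_eq]
    rcases le_total s t with h | h
    · exact hmono s hs t ht h
    · rw [norm_sub_rev, abs_sub_comm]; exact hmono t ht s hs h
  exact hlip.continuousOn

theorem IsLinSolution.hasDerivWithinAt_pair (φ : 𝓢(E2, ℂ)) {s : ℝ} (hs : s ∈ Icc a b) :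
    HasDerivWithinAt (fun s => pair φ (w s)) (I * pair (harm φ) (w s)) (Icc a b) s := by
  have hab : a ≤ b := hs.1.trans hs.2
  have ha : a ∈ Icc a b := ⟨le_rfl, hab⟩
  have hco : ContinuousOn (fun r => I * pair (harm φ) (w r)) (Icc a b) :=
    continuousOn_const.mul (hw.continuousOn_pair hK (harm φ))
  have : Fact (s ∈ Icc a b) := ⟨hs⟩
  have h := intervalIntegral.integral_hasDerivWithinAt_right (s := Icc a b) (t := Icc a b)
    (hw.integral_pair hK φ hs.1 ha hs).1
    (hco.stronglyMeasurableAtFilter_nhdsWithin measurableSet_Icc s) (hco s hs)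
  refine (h.add_const (pair φ (w a))).congr (fun r hr => ?_) ?_
  · rw [(hw.integral_pair hK φ hr.1 ha hr).2]; ring
  · rw [(hw.integral_pair hK φ hs.1 ha hs).2]; ring

theorem IsLinSolution.hasDerivWithinAt_pair_shift (φ : 𝓢(E2, ℂ)) {c h : ℝ} {S : Set ℝ}
    (hS : ∀ h ∈ S, c + h ∈ Icc a b) (hh : h ∈ S) :
    HasDerivWithinAt (fun h => pair φ (w (c + h))) (I * pair (harm φ) (w (c + h))) S h := by
  have h1 : HasDerivWithinAt (fun h : ℝ => c + h) 1 S h := (hasDerivWithinAt_id h S).const_add c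
  simpa [Function.comp_def] using (hw.hasDerivWithinAt_pair hK φ (hS h hh)).scomp h h1 hS

theorem IsLinSolution.pair_harm_shift {φ ψ : 𝓢(E2, ℂ)} {s t α β : ℝ} (hαβ : α < β)
    (hs : ∀ h ∈ Icc α β, s + h ∈ Icc a b) (ht : ∀ h ∈ Icc α β, t + h ∈ Icc a b)
    (heq : ∀ h ∈ Icc α β, pair φ (w (s + h)) = pair ψ (w (t + h))) :
    ∀ h ∈ Icc α β, pair (harm φ) (w (s + h)) = pair (harm ψ) (w (t + h)) := by
  intro h hh
  have d₁ := hw.hasDerivWithinAt_pair_shift hK φ hs hh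
  have d₂ := (hw.hasDerivWithinAt_pair_shift hK ψ ht hh).congr heq (heq h hh)
  exact mul_left_cancel₀ I_ne_zero ((uniqueDiffOn_Icc hαβ h hh).eq_deriv _ d₁ d₂)

theorem IsLinSolution.conserved_of_lt {s t : ℝ} (hst : s ≤ t) (hlt : t - s < b - a)
    (hs : s ∈ Icc a b) (ht : t ∈ Icc a b) :
    mass (w s) = mass (w t) ∧ energy (w s) = energy (w t) ∧ mass (harm (w s)) = mass (harm (w t)) := by
  have hαβ : a - s < b - t := by linarith
  have h0 : (0 : ℝ) ∈ Icc (a - s) (b - t) := ⟨by linarith [hs.1], by linarith [ht.2]⟩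
  have hS : ∀ h ∈ Icc (a - s) (b - t), s + h ∈ Icc a b := fun h hh =>
    ⟨by linarith [hh.1], by linarith [hh.2]⟩
  have hT : ∀ h ∈ Icc (a - s) (b - t), t + h ∈ Icc a b := fun h hh =>
    ⟨by linarith [hh.1], by linarith [hh.2]⟩
  have e₀ : ∀ h ∈ Icc (a - s) (b - t), pair (w s) (w (s + h)) = pair (w t) (w (t + h)) := by
    intro h hh
    have := hw.pair_shift hK (t₁ := s) (t₂ := s + h) (r := t - s) (by linarith) hs (hS h hh)
      (by simpa using ht) (by have := hT h hh; rwa [show s + h + (t - s) = t + h by ring])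
    rw [← this, show s + (t - s) = t by ring, show s + h + (t - s) = t + h by ring]
  have e₁ := hw.pair_harm_shift hK hαβ hS hT e₀
  have e₂ := hw.pair_harm_shift hK hαβ hS hT e₁
  have f₀ := e₀ 0 h0
  have f₁ := e₁ 0 h0
  have f₂ := e₂ 0 h0
  simp only [add_zero, pair_self, ← pair_harm, pair_harm_self, ofReal_inj] at f₀ f₁ f₂
  exact ⟨f₀, f₁, f₂⟩

theorem IsLinSolution.conserved_on {s t : ℝ} (hab : a < b) (hs : s ∈ Icc a b) (ht : t ∈ Icc a b) :
    mass (w s) = mass (w t) ∧ energy (w s) = energy (w t) ∧ mass (harm (w s)) = mass (harm (w t)) := by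
  wlog hst : s ≤ t generalizing s t
  · obtain ⟨h₁, h₂, h₃⟩ := this ht hs (not_le.mp hst).le
    exact ⟨h₁.symm, h₂.symm, h₃.symm⟩
  have hm : (s + t) / 2 ∈ Icc a b := ⟨by linarith [hs.1, ht.1], by linarith [hs.2, ht.2]⟩
  obtain ⟨h₁, h₂, h₃⟩ := hw.conserved_of_lt hK (s := s) (t := (s + t) / 2) (by linarith)
    (by linarith [hs.1, ht.2]) hs hm
  obtain ⟨k₁, k₂, k₃⟩ := hw.conserved_of_lt hK (s := (s + t) / 2) (t := t) (by linarith)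
    (by linarith [hs.1, ht.2]) hm ht
  exact ⟨h₁.trans k₁, h₂.trans k₂, h₃.trans k₃⟩

end Conservation

/-- Conservation of the mass, the energy, and the `L²` norm of the oscillator along the flow. -/
theorem IsLinSolution.conserved {w : ℝ → 𝓢(E2, ℂ)} (hw : IsLinSolution w) (s t : ℝ) :
    mass (w s) = mass (w t) ∧ energy (w s) = energy (w t) ∧ mass (harm (w s)) = mass (harm (w t)) := by
  have hconst : ConstOnBdd (fun t => mass (w t) + mass (harm (w t))) := by
    intro a b K hab hK s hs t ht
    obtain ⟨h₁, -, h₃⟩ := hw.conserved_on hK hab hs ht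
    simp only [h₁, h₃]
  have hclosed : ∀ K, IsClosed {t | mass (w t) + mass (harm (w t)) ≤ K} := by
    intro K
    have := isClosed_setOf_integral_le (h := fun t x => ‖w t x‖ ^ 2 + ‖harm (w t) x‖ ^ 2)
      (Continuous.fun_add (hw.continuous.norm.pow 2) (hw.harm_comp.continuous.norm.pow 2)) (fun _ _ => by positivity)
      (fun t => (integrable_norm_sq _).add (integrable_norm_sq _)) K
    simp_rw [integral_add (integrable_norm_sq (μ := volume) (w _))
      (integrable_norm_sq (harm (w _)))] at this
    exact this
  have hb := hconst.const hclosed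
  refine hw.conserved_on (a := min s t) (b := max s t + 1) (fun r _ => (hb r 0).le)
    (by linarith [min_le_max (a := s) (b := t)]) ⟨min_le_left _ _, ?_⟩ ⟨min_le_right _ _, ?_⟩
  · linarith [le_max_left s t]
  · linarith [le_max_right s t]

section Tensor

variable {V₁ V₂ : Type*} [NormedAddCommGroup V₁] [NormedSpace ℝ V₁] [NormedAddCommGroup V₂]
  [NormedSpace ℝ V₂]

theorem norm_iteratedFDeriv_comp_clm_le {V W : Type*} [NormedAddCommGroup V] [NormedSpace ℝ V]
    [NormedAddCommGroup W] [NormedSpace ℝ W] (f : 𝓢(W, ℂ)) (L : V →L[ℝ] W) (hL : ‖L‖ ≤ 1)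
    (n : ℕ) (z : V) : ‖iteratedFDeriv ℝ n (f ∘ L) z‖ ≤ ‖iteratedFDeriv ℝ n f (L z)‖ := by
  rw [L.iteratedFDeriv_comp_right (f.smooth n) z le_rfl]
  refine (ContinuousMultilinearMap.norm_compContinuousLinearMap_le _ _).trans ?_
  refine mul_le_of_le_one_right (norm_nonneg _) ?_
  simpa using pow_le_one₀ (norm_nonneg L) hL

/-- The tensor product of two Schwartz functions. -/
def tens (f : 𝓢(V₁, ℂ)) (g : 𝓢(V₂, ℂ)) : 𝓢(V₁ × V₂, ℂ) where
  toFun z := f z.1 * g z.2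
  smooth' := ((f.smooth _).comp contDiff_fst).mul ((g.smooth _).comp contDiff_snd)
  decay' k n := by
    set A := fun k i => SchwartzMap.seminorm ℝ k i f
    set B := fun k i => SchwartzMap.seminorm ℝ k i g
    refine ⟨∑ i ∈ Finset.range (n + 1), (n.choose i : ℝ) *
      (A k i * B 0 (n - i) + A 0 i * B k (n - i)), fun z => ?_⟩
    have h := norm_iteratedFDeriv_mul_le (𝕜 := ℝ) (N := n)
      (f := f ∘ ContinuousLinearMap.fst ℝ V₁ V₂) (g := g ∘ ContinuousLinearMap.snd ℝ V₁ V₂)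
      ((f.smooth n).comp contDiff_fst) ((g.smooth n).comp contDiff_snd) z le_rfl
    refine (mul_le_mul_of_nonneg_left h (by positivity)).trans ?_
    rw [Finset.mul_sum]
    refine Finset.sum_le_sum fun i _ => ?_
    have hf := norm_iteratedFDeriv_comp_clm_le f (ContinuousLinearMap.fst ℝ V₁ V₂)
      (ContinuousLinearMap.norm_fst_le ℝ V₁ V₂) i z
    have hg := norm_iteratedFDeriv_comp_clm_le g (ContinuousLinearMap.snd ℝ V₁ V₂)
      (ContinuousLinearMap.norm_snd_le ℝ V₁ V₂) (n - i) z
    have hz : ‖z‖ ^ k ≤ ‖z.1‖ ^ k + ‖z.2‖ ^ k := by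
      rw [Prod.norm_def]
      rcases max_cases ‖z.1‖ ‖z.2‖ with ⟨h, _⟩ | ⟨h, _⟩ <;> rw [h]
      · exact le_add_of_nonneg_right (by positivity)
      · exact le_add_of_nonneg_left (by positivity)
    have a₁ := SchwartzMap.le_seminorm ℝ k i f z.1
    have a₂ := SchwartzMap.le_seminorm ℝ 0 i f z.1
    have b₁ := SchwartzMap.le_seminorm ℝ k (n - i) g z.2
    have b₂ := SchwartzMap.le_seminorm ℝ 0 (n - i) g z.2
    rw [pow_zero, one_mul] at a₂ b₂
    simp only [ContinuousLinearMap.coe_fst', ContinuousLinearMap.coe_snd'] at hf hg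
    set p := ‖iteratedFDeriv ℝ i f z.1‖
    set q := ‖iteratedFDeriv ℝ (n - i) g z.2‖
    calc _ ≤ (‖z.1‖ ^ k + ‖z.2‖ ^ k) * ((n.choose i : ℝ) * p * q) := by
          gcongr
          exacts [hf, hg]
      _ = (n.choose i : ℝ) * ((‖z.1‖ ^ k * p) * q + p * (‖z.2‖ ^ k * q)) := by ring
      _ ≤ _ := by
        gcongr

@[simp]
theorem tens_apply (f : 𝓢(V₁, ℂ)) (g : 𝓢(V₂, ℂ)) (z : V₁ × V₂) : tens f g z = f z.1 * g z.2 := rfl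

theorem lineDerivOp_tens (f : 𝓢(V₁, ℂ)) (g : 𝓢(V₂, ℂ)) (v : V₁ × V₂) :
    ∂_{v} (tens f g) = tens (∂_{v.1} f) g + tens f (∂_{v.2} g) := by
  ext z
  have h₁ : HasFDerivAt (fun z : V₁ × V₂ => f z.1) _ z := (f.hasFDerivAt z.1).comp z hasFDerivAt_fst
  have h₂ : HasFDerivAt (fun z : V₁ × V₂ => g z.2) _ z := (g.hasFDerivAt z.2).comp z hasFDerivAt_snd
  have h : HasFDerivAt (tens f g) _ z := h₁.mul h₂
  rw [lineDerivOp_apply_eq_fderiv, h.fderiv]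
  simp [lineDerivOp_apply_eq_fderiv]
  ring

end Tensor

theorem schwartz_lineDerivOp_comm {V : Type*} [NormedAddCommGroup V] [NormedSpace ℝ V]
    (f : 𝓢(V, ℂ)) (v w : V) : ∂_{v} (∂_{w} f) = ∂_{w} (∂_{v} f) := by
  ext z
  exact fderiv_fderiv_apply_comm (f.smooth _) w v z

theorem lineDerivOp_harm (k : Fin 2) (f : 𝓢(E2, ℂ)) (x : E2) :
    (∂_{coordVec k} (harm f)) x = harm (∂_{coordVec k} f) x + 2 * (x k : ℂ) * f x := by
  have hc : ∂_{coordVec k} (Δ f) = Δ (∂_{coordVec k} f) := by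
    simp only [laplacian_eq_sum (EuclideanSpace.basisFun (Fin 2) ℝ), lineDerivOp_sum]
    refine Finset.sum_congr rfl fun i _ => ?_
    rw [schwartz_lineDerivOp_comm (∂_{_} f), schwartz_lineDerivOp_comm f]
  have h₁ : (∂_{coordVec k} (smulLeftCLM ℂ (fun x : E2 => (‖x‖ : ℂ) ^ 2) f)) x =
      (‖x‖ : ℂ) ^ 2 * (∂_{coordVec k} f) x + 2 * (x k : ℂ) * f x := by
    have e : ⇑(smulLeftCLM ℂ (fun x : E2 => (‖x‖ : ℂ) ^ 2) f) =
        fun x => ((‖x‖ ^ 2 : ℝ) : ℂ) * f x := by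
      ext x; simp [smulLeftCLM_apply_apply hasTemperateGrowth_norm_sq_complex]
    have hn : HasFDerivAt (fun x : E2 => ((‖x‖ ^ 2 : ℝ) : ℂ)) _ x :=
      ofRealCLM.hasFDerivAt.comp x (hasStrictFDerivAt_norm_sq x).hasFDerivAt
    rw [lineDerivOp_apply_eq_fderiv, e, (hn.fun_mul (f.hasFDerivAt x)).fderiv]
    simp [lineDerivOp_apply_eq_fderiv, EuclideanSpace.inner_single_right]
    ring
  unfold harm
  rw [lineDerivOp_add, lineDerivOp_neg, hc]
  simp only [add_apply, neg_apply, h₁, smulLeftCLM_apply_apply hasTemperateGrowth_norm_sq_complex,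
    smul_eq_mul]
  ring

/-- The translation directions on `ℝ² × ℝ²`. -/
def diagV (k : Fin 2) : E2 × E2 := (coordVec k, coordVec k)

/-- The directions of relative motion on `ℝ² × ℝ²`. -/
def antiV (k : Fin 2) : E2 × E2 := (coordVec k, -coordVec k)

/-- The relative coordinates. -/
def relC (k : Fin 2) (z : E2 × E2) : ℝ := z.1 k - z.2 k

/-- The inverse of the regularised distance `(M⁻² + |x - y|²)^(1/2)`. -/
def invDist (M : ℝ) (z : E2 × E2) : ℝ := (√((M⁻¹) ^ 2 + ∑ i, relC i z ^ 2))⁻¹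

/-- The virial weight `(x - y) / (M⁻² + |x - y|²)^(1/2)`. -/
def virialW (M : ℝ) (k : Fin 2) (z : E2 × E2) : ℝ := relC k z * invDist M z

/-- The Hessian of the regularised distance. -/
def virialH (M : ℝ) (k j : Fin 2) (z : E2 × E2) : ℝ :=
  (if k = j then 1 else 0) * invDist M z - relC k z * relC j z * invDist M z ^ 3

theorem continuous_relC (k : Fin 2) : Continuous (relC k) := by unfold relC; fun_prop

section Weight

variable {M : ℝ} (hM : 0 < M) (z : E2 × E2)

include hM

theorem regDist_pos : 0 < (M⁻¹) ^ 2 + ∑ i, relC i z ^ 2 := by positivity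

theorem invDist_pos : 0 < invDist M z := inv_pos.mpr (Real.sqrt_pos.mpr (regDist_pos hM z))

theorem invDist_sq_mul : invDist M z ^ 2 * ((M⁻¹) ^ 2 + ∑ i, relC i z ^ 2) = 1 := by
  have := regDist_pos hM z
  rw [invDist, inv_pow, Real.sq_sqrt this.le, inv_mul_cancel₀ this.ne']

theorem continuous_invDist : Continuous (invDist M) := by
  unfold invDist
  refine Continuous.inv₀ ?_ fun z => (Real.sqrt_pos.mpr (regDist_pos hM z)).ne'
  have := continuous_relC
  fun_prop

theorem continuous_virialW (k : Fin 2) : Continuous (virialW M k) :=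
  (continuous_relC k).mul (continuous_invDist hM)

theorem continuous_virialH (k j : Fin 2) : Continuous (virialH M k j) :=
  (continuous_const.mul (continuous_invDist hM)).sub
    (((continuous_relC k).mul (continuous_relC j)).mul ((continuous_invDist hM).pow 3))

theorem sum_virialW_sq_le : ∑ k, virialW M k z ^ 2 ≤ 1 := by
  have := invDist_sq_mul hM z
  simp only [virialW, mul_pow, ← Finset.sum_mul]
  nlinarith [sq_nonneg (invDist M z * M⁻¹)]

theorem abs_virialW_le (k : Fin 2) : |virialW M k z| ≤ 1 := by
  rw [← sq_le_one_iff_abs_le_one]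
  exact (Finset.single_le_sum (f := fun k => virialW M k z ^ 2) (fun _ _ => sq_nonneg _)
    (Finset.mem_univ k)).trans (sum_virialW_sq_le hM z)

theorem invDist_le : invDist M z ≤ M := by
  rw [invDist, inv_le_comm₀ (Real.sqrt_pos.mpr (regDist_pos hM z)) hM]
  refine Real.le_sqrt_of_sq_le ?_
  have : 0 ≤ ∑ i, relC i z ^ 2 := by positivity
  linarith

theorem abs_virialH_le (k j : Fin 2) : |virialH M k j z| ≤ 2 * M := by
  have e : virialH M k j z =
      ((if k = j then 1 else 0) - virialW M k z * virialW M j z) * invDist M z := by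
    simp only [virialH, virialW]; ring
  have hp := invDist_pos hM z
  rw [e, abs_mul, abs_of_pos hp]
  refine mul_le_mul ?_ (invDist_le hM z) hp.le zero_le_two
  refine (abs_sub _ _).trans ?_
  rw [abs_mul]
  have h₁ := abs_virialW_le hM z k
  have h₂ := abs_virialW_le hM z j
  have h₃ := mul_le_mul h₁ h₂ (abs_nonneg _) zero_le_one
  have h₄ : |(if k = j then (1 : ℝ) else 0)| ≤ 1 := by split_ifs <;> simp
  linarith

omit hM in
theorem hasLineDerivAt_virialW_diag (k j : Fin 2) :
    HasLineDerivAt ℝ (virialW M k) 0 z (diagV j) := by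
  have : ∀ i (t : ℝ), relC i (z + t • diagV j) = relC i z := by
    intro i t; simp [relC, diagV]
  unfold HasLineDerivAt
  simp only [virialW, invDist, this]
  exact hasDerivAt_const _ _

theorem hasLineDerivAt_virialW_anti (k j : Fin 2) :
    HasLineDerivAt ℝ (virialW M k) (2 * virialH M k j z) z (antiV j) := by
  have e : ∀ i (t : ℝ), relC i (z + t • antiV j) = relC i z + t * (2 * if i = j then 1 else 0) := by
    intro i t
    rcases eq_or_ne i j with rfl | h
    · simp [relC, antiV]; ring
    · simp [relC, antiV, h]
  have hr : ∀ i, HasDerivAt (fun t : ℝ => relC i (z + t • antiV j)) (2 * if i = j then 1 else 0) 0 := by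
    intro i
    simp only [e]
    simpa using ((hasDerivAt_id (0 : ℝ)).mul_const (2 * if i = j then (1 : ℝ) else 0)).const_add (relC i z)
  have hm : HasDerivAt (fun t : ℝ => (M⁻¹) ^ 2 + ∑ i, relC i (z + t • antiV j) ^ 2)
      (4 * relC j z) 0 := by
    have := (HasDerivAt.fun_sum (u := Finset.univ) fun i _ => (hr i).fun_pow 2).const_add ((M⁻¹) ^ 2)
    refine this.congr_deriv ?_
    simp
    ring
  have hpos := regDist_pos hM z
  have hs := ((hm.sqrt (by simpa using hpos.ne')).fun_inv
    (by simpa using (Real.sqrt_pos.mpr hpos).ne'))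
  have := (hr k).fun_mul hs
  unfold HasLineDerivAt virialW invDist
  refine this.congr_deriv ?_
  simp only [zero_smul, add_zero, virialH, invDist]
  field_simp
  ring

omit hM in
theorem virialH_quadratic (F : Fin 2 → ℂ) :
    ∑ k, ∑ j, (virialH M k j z : ℂ) * (conj (F j) * F k) =
      ((invDist M z * ∑ k, ‖F k‖ ^ 2 - invDist M z ^ 3 * ‖∑ k, (relC k z : ℂ) * F k‖ ^ 2 : ℝ) : ℂ) := by
  have h : ∀ c : ℂ, ((‖c‖ ^ 2 : ℝ) : ℂ) = conj c * c := fun c => by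
    rw [← normSq_eq_norm_sq, normSq_eq_conj_mul_self]
  push_cast
  simp only [← ofReal_pow, h]
  simp [Fin.sum_univ_two, virialH]
  ring

/-- Coercivity of the Hessian of the regularised distance near the diagonal. -/
theorem virialH_coercive (F : Fin 2 → ℂ) :
    0 ≤ invDist M z * ∑ k, ‖F k‖ ^ 2 - invDist M z ^ 3 * ‖∑ k, (relC k z : ℂ) * F k‖ ^ 2 ∧
    (∑ i, relC i z ^ 2 < (M⁻¹) ^ 2 → M * ∑ k, ‖F k‖ ^ 2 ≤
      3 * (invDist M z * ∑ k, ‖F k‖ ^ 2 - invDist M z ^ 3 * ‖∑ k, (relC k z : ℂ) * F k‖ ^ 2)) := by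
  have hs := invDist_pos hM z
  have hsq := invDist_sq_mul hM z
  set s := invDist M z
  set N := ∑ k, ‖F k‖ ^ 2 with hN
  set ρ := ∑ i, relC i z ^ 2 with hρ
  have hN0 : 0 ≤ N := by positivity
  have hρ0 : 0 ≤ ρ := by positivity
  have hCS : ‖∑ k, (relC k z : ℂ) * F k‖ ^ 2 ≤ ρ * N := by
    have h₁ : ‖∑ k, (relC k z : ℂ) * F k‖ ≤ ∑ k, |relC k z| * ‖F k‖ := by
      refine (norm_sum_le _ _).trans_eq ?_
      simp
    calc _ ≤ (∑ k, |relC k z| * ‖F k‖) ^ 2 := by gcongr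
      _ ≤ (∑ k, |relC k z| ^ 2) * ∑ k, ‖F k‖ ^ 2 := Finset.sum_mul_sq_le_sq_mul_sq _ _ _
      _ = ρ * N := by simp [hρ, hN]
  have hlow : s ^ 3 * (M⁻¹) ^ 2 * N ≤ s * N - s ^ 3 * ‖∑ k, (relC k z : ℂ) * F k‖ ^ 2 := by
    have h₁ : s ^ 3 * ‖∑ k, (relC k z : ℂ) * F k‖ ^ 2 ≤ s ^ 3 * (ρ * N) := by gcongr
    have h₂ : s * N = s ^ 3 * (M⁻¹) ^ 2 * N + s ^ 3 * (ρ * N) := by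
      linear_combination (-s * N) * hsq
    linarith
  refine ⟨(by positivity : (0 : ℝ) ≤ s ^ 3 * (M⁻¹) ^ 2 * N).trans hlow, fun hlt => ?_⟩
  have hM2 : (M⁻¹) ^ 2 * M ^ 2 = 1 := by field_simp
  have h₁ : M ^ 2 ≤ 2 * s ^ 2 := by
    have : s ^ 2 * ρ ≤ s ^ 2 * (M⁻¹) ^ 2 := by gcongr
    have h2 : 1 ≤ 2 * (s ^ 2 * (M⁻¹) ^ 2) := by linarith
    calc M ^ 2 = M ^ 2 * 1 := by ring
      _ ≤ M ^ 2 * (2 * (s ^ 2 * (M⁻¹) ^ 2)) := by gcongr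
      _ = _ := by linear_combination 2 * s ^ 2 * hM2
  have h₂ : M ^ 3 ≤ 3 * s ^ 3 := by
    refine le_of_sq_le_sq ?_ (by positivity)
    have := pow_le_pow_left₀ (by positivity) h₁ 3
    nlinarith [this, pow_pos hs 6]
  have h₃ : M ≤ 3 * (s ^ 3 * (M⁻¹) ^ 2) := by
    calc M = M ^ 3 * (M⁻¹) ^ 2 := by field_simp
      _ ≤ 3 * s ^ 3 * (M⁻¹) ^ 2 := by gcongr
      _ = _ := by ring
  calc M * N ≤ 3 * (s ^ 3 * (M⁻¹) ^ 2) * N := by gcongr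
    _ = 3 * (s ^ 3 * (M⁻¹) ^ 2 * N) := by ring
    _ ≤ _ := by gcongr

end Weight

section IntegrationByParts

variable {V : Type*} [NormedAddCommGroup V] [NormedSpace ℝ V] [MeasurableSpace V] [BorelSpace V]
  [FiniteDimensional ℝ V] {μ : Measure V} [μ.IsAddHaarMeasure]

theorem integrable_weight_mul {a : V → ℝ} {A : ℝ} (ha : Continuous a) (hA : ∀ z, |a z| ≤ A)
    (F G : 𝓢(V, ℂ)) : Integrable (fun z => (a z : ℂ) * (conj (F z) * G z)) μ :=
  (integrable_conj_mul F G).bdd_mul (c := A) (continuous_ofReal.comp ha).aestronglyMeasurable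
    (Eventually.of_forall fun z => by simpa using hA z)

omit [MeasurableSpace V] [BorelSpace V] [FiniteDimensional ℝ V] in
theorem hasLineDerivAt_weight_mul_conj {a : V → ℝ} {a' : ℝ} {v z : V} (F : 𝓢(V, ℂ))
    (hd : HasLineDerivAt ℝ a a' z v) :
    HasLineDerivAt ℝ (fun z => (a z : ℂ) * conj (F z))
      ((a' : ℂ) * conj (F z) + (a z : ℂ) * conj ((∂_{v} F) z)) z v := by
  have h₀ : HasDerivAt (fun t : ℝ => a (z + t • v)) a' 0 := hd
  have h₂ : HasDerivAt (fun t : ℝ => conjS F (z + t • v)) (conj ((∂_{v} F) z)) 0 := by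
    rw [← conjS_apply, ← lineDerivOp_conjS]
    exact ((conjS F).hasFDerivAt z).hasLineDerivAt v
  have := h₀.ofReal_comp.fun_mul h₂
  simp only [zero_smul, add_zero, conjS_apply] at this
  exact this

theorem integral_weight_mul_lineDerivOp {a a' : V → ℝ} {A A' : ℝ} {v : V} (ha : Continuous a)
    (hA : ∀ z, |a z| ≤ A) (ha' : Continuous a') (hA' : ∀ z, |a' z| ≤ A')
    (hd : ∀ z, HasLineDerivAt ℝ a (a' z) z v) (F G : 𝓢(V, ℂ)) :
    ∫ z, (a z : ℂ) * (conj (F z) * (∂_{v} G) z) ∂μ =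
      -((∫ z, (a' z : ℂ) * (conj (F z) * G z) ∂μ) +
        ∫ z, (a z : ℂ) * (conj ((∂_{v} F) z) * G z) ∂μ) := by
  have i₁ := integrable_weight_mul (μ := μ) ha' hA' F G
  have i₂ := integrable_weight_mul (μ := μ) ha hA (∂_{v} F) G
  have i₃ := integrable_weight_mul (μ := μ) ha hA F (∂_{v} G)
  have i₄ := integrable_weight_mul (μ := μ) ha hA F G
  have hdF : ∀ z, HasLineDerivAt ℝ (fun z => (a z : ℂ) * conj (F z))
      ((a' z : ℂ) * conj (F z) + (a z : ℂ) * conj ((∂_{v} F) z)) z v :=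
    fun z => hasLineDerivAt_weight_mul_conj F (hd z)
  have hdG : ∀ z, HasLineDerivAt ℝ G ((∂_{v} G) z) z v := fun z => (G.hasFDerivAt z).hasLineDerivAt v
  rw [← integral_add i₁ i₂]
  have e₁ : Integrable (fun z => ContinuousLinearMap.mul ℝ ℂ
      ((a' z : ℂ) * conj (F z) + (a z : ℂ) * conj ((∂_{v} F) z)) (G z)) μ := by
    simp only [ContinuousLinearMap.mul_apply', add_mul, mul_assoc]
    exact i₁.add i₂
  have e₂ : Integrable (fun z => ContinuousLinearMap.mul ℝ ℂ
      ((a z : ℂ) * conj (F z)) ((∂_{v} G) z)) μ := by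
    simp only [ContinuousLinearMap.mul_apply', mul_assoc]
    exact i₃
  have e₃ : Integrable (fun z => ContinuousLinearMap.mul ℝ ℂ
      ((a z : ℂ) * conj (F z)) (G z)) μ := by
    simp only [ContinuousLinearMap.mul_apply', mul_assoc]
    exact i₄
  have := integral_bilinear_hasLineDerivAt_right_eq_neg_left_of_integrable
    e₁ e₂ e₃ (fun z _ => hdF z) (fun z _ => hdG z)
  simp only [ContinuousLinearMap.mul_apply', add_mul, mul_assoc] at this
  exact this

end IntegrationByParts

instance : (volume : Measure (E2 × E2)).IsAddHaarMeasure :=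
  inferInstanceAs ((volume : Measure E2).prod volume).IsAddHaarMeasure

theorem schwartz_lineDerivOp_sub {V : Type*} [NormedAddCommGroup V] [NormedSpace ℝ V] (v : V)
    (f g : 𝓢(V, ℂ)) : ∂_{v} (f - g) = ∂_{v} f - ∂_{v} g := by
  rw [sub_eq_add_neg, lineDerivOp_add, lineDerivOp_neg, sub_eq_add_neg]

/-- The commutator form of the oscillator on tensor products. -/
def tensL (φ χ : 𝓢(E2, ℂ)) : 𝓢(E2 × E2, ℂ) := tens (harm φ) χ - tens φ (harm χ)

theorem lineDerivOp_diagV_tens (k : Fin 2) (φ χ : 𝓢(E2, ℂ)) :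
    ∂_{diagV k} (tens φ χ) = tens (∂_{coordVec k} φ) χ + tens φ (∂_{coordVec k} χ) :=
  lineDerivOp_tens _ _ _

theorem lineDerivOp_antiV_tens (k : Fin 2) (φ χ : 𝓢(E2, ℂ)) :
    ∂_{antiV k} (tens φ χ) = tens (∂_{coordVec k} φ) χ - tens φ (∂_{coordVec k} χ) := by
  rw [lineDerivOp_tens]
  ext z
  simp [antiV, lineDerivOp_left_neg, sub_eq_add_neg]

theorem harm_apply_lineDerivOp (f : 𝓢(E2, ℂ)) (x : E2) :
    harm f x = -∑ j, (∂_{coordVec j} (∂_{coordVec j} f)) x + (‖x‖ : ℂ) ^ 2 * f x :=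
  harm_apply f x

theorem tensL_apply (φ χ : 𝓢(E2, ℂ)) (z : E2 × E2) :
    tensL φ χ z = -∑ j, (∂_{antiV j} (∂_{diagV j} (tens φ χ))) z +
      ((‖z.1‖ : ℂ) ^ 2 - (‖z.2‖ : ℂ) ^ 2) * tens φ χ z := by
  simp only [tensL, lineDerivOp_diagV_tens, lineDerivOp_antiV_tens, lineDerivOp_add, sub_apply,
    add_apply, tens_apply, harm_apply_lineDerivOp, Fin.sum_univ_two]
  ring

theorem lineDerivOp_diagV_tensL_apply (k : Fin 2) (φ χ : 𝓢(E2, ℂ)) (z : E2 × E2) :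
    (∂_{diagV k} (tensL φ χ)) z =
      -∑ j, (∂_{diagV j} (∂_{antiV j} (∂_{diagV k} (tens φ χ)))) z +
      2 * (relC k z : ℂ) * tens φ χ z +
      ((‖z.1‖ : ℂ) ^ 2 - (‖z.2‖ : ℂ) ^ 2) * (∂_{diagV k} (tens φ χ)) z := by
  simp only [tensL, lineDerivOp_diagV_tens, lineDerivOp_antiV_tens, lineDerivOp_add,
    schwartz_lineDerivOp_sub, sub_apply, add_apply, tens_apply, lineDerivOp_harm, harm_apply_lineDerivOp,
    Fin.sum_univ_two, relC]
  push_cast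
  ring

theorem hasTemperateGrowth_relC (k : Fin 2) :
    Function.HasTemperateGrowth (fun z : E2 × E2 => (relC k z : ℂ)) := by
  have := (ofRealCLM ∘L (EuclideanSpace.proj k : E2 →L[ℝ] ℝ) ∘L
    (ContinuousLinearMap.fst ℝ E2 E2 - ContinuousLinearMap.snd ℝ E2 E2)).hasTemperateGrowth
  convert this using 1
  ext z
  simp [relC]

theorem integrable_virialW_mul_relC {M : ℝ} (hM : 0 < M) (k : Fin 2) (Ψ : 𝓢(E2 × E2, ℂ)) :
    Integrable (fun z => (virialW M k z * relC k z : ℂ) * (conj (Ψ z) * Ψ z)) := by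
  refine (integrable_weight_mul (continuous_virialW hM k) (fun z => abs_virialW_le hM z k) Ψ
    (smulLeftCLM ℂ (fun z => (relC k z : ℂ)) Ψ)).congr (Eventually.of_forall fun z => ?_)
  simp only [smulLeftCLM_apply_apply (hasTemperateGrowth_relC k), smul_eq_mul]
  ring

theorem integrable_virialH_mul {M : ℝ} (hM : 0 < M) (k j : Fin 2) (F G : 𝓢(E2 × E2, ℂ)) :
    Integrable (fun z => (virialH M k j z : ℂ) * (conj (F z) * G z)) :=
  integrable_weight_mul (continuous_virialH hM k j) (fun z => abs_virialH_le hM z k j) F G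

/-- The virial identity on a time slice. -/
theorem virial_identity {M : ℝ} (hM : 0 < M) (φ χ : 𝓢(E2, ℂ)) :
    ∫ z, ∑ k, (virialW M k z : ℂ) * (conj (I * tensL φ χ z) * (∂_{diagV k} (tens φ χ)) z +
      conj (tens φ χ z) * (I * (∂_{diagV k} (tensL φ χ)) z)) =
    2 * I * ∫ z, ((∑ k, (virialW M k z * relC k z : ℂ)) * (conj (tens φ χ z) * tens φ χ z) -
      ∑ k, ∑ j, (virialH M k j z : ℂ) *
        (conj ((∂_{diagV j} (tens φ χ)) z) * (∂_{diagV k} (tens φ χ)) z)) := by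
  set Ψ := tens φ χ with hΨ
  set F := fun k => (∂_{diagV k} Ψ : 𝓢(E2 × E2, ℂ)) with hF
  have hW := continuous_virialW hM
  have hWb := fun k z => abs_virialW_le hM z k
  have hH : ∀ k j, Continuous (fun z => 2 * virialH M k j z) := fun k j =>
    continuous_const.mul (continuous_virialH hM k j)
  have hHb : ∀ k j z, |2 * virialH M k j z| ≤ 2 * (2 * M) := fun k j z => by
    rw [abs_mul, abs_two]; gcongr; exact abs_virialH_le hM z k j
  have ibp₁ : ∀ k j, ∫ z, (virialW M k z : ℂ) * (conj (Ψ z) * (∂_{diagV j} (∂_{antiV j} (F k))) z) =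
      -∫ z, (virialW M k z : ℂ) * (conj (F j z) * (∂_{antiV j} (F k)) z) := by
    intro k j
    have := integral_weight_mul_lineDerivOp (μ := volume) (a' := 0) (A' := 0) (hW k) (hWb k)
      continuous_zero (by simp) (fun z => hasLineDerivAt_virialW_diag z k j) Ψ (∂_{antiV j} (F k))
    simpa using this
  have ibp₂ : ∀ k j, ∫ z, (virialW M k z : ℂ) * (conj (F j z) * (∂_{antiV j} (F k)) z) =
      -((∫ z, ((2 * virialH M k j z : ℝ) : ℂ) * (conj (F j z) * F k z)) +
        ∫ z, (virialW M k z : ℂ) * (conj ((∂_{antiV j} (F j)) z) * F k z)) := fun k j =>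
    integral_weight_mul_lineDerivOp (hW k) (hWb k) (hH k j) (hHb k j)
      (fun z => hasLineDerivAt_virialW_anti hM z k j) (F j) (F k)
  have j₁ : ∀ k j, Integrable (fun z => (virialW M k z : ℂ) *
      (conj (Ψ z) * (∂_{diagV j} (∂_{antiV j} (F k))) z)) := fun k j =>
    integrable_weight_mul (hW k) (hWb k) _ _
  have j₂ : ∀ k j, Integrable (fun z => (virialW M k z : ℂ) *
      (conj ((∂_{antiV j} (F j)) z) * F k z)) := fun k j =>
    integrable_weight_mul (hW k) (hWb k) _ _
  have j₃ : ∀ k j, Integrable (fun z => ((2 * virialH M k j z : ℝ) : ℂ) *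
      (conj (F j z) * F k z)) := fun k j =>
    integrable_weight_mul (hH k j) (hHb k j) _ _
  have key : ∀ k j, ∫ z, ((virialW M k z : ℂ) * (conj ((∂_{antiV j} (F j)) z) * F k z) -
      (virialW M k z : ℂ) * (conj (Ψ z) * (∂_{diagV j} (∂_{antiV j} (F k))) z) +
      ((2 * virialH M k j z : ℝ) : ℂ) * (conj (F j z) * F k z)) = 0 := by
    intro k j
    have j₂₁ : Integrable (fun z => (virialW M k z : ℂ) * (conj ((∂_{antiV j} (F j)) z) * F k z) -
        (virialW M k z : ℂ) * (conj (Ψ z) * (∂_{diagV j} (∂_{antiV j} (F k))) z)) :=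
      (j₂ k j).sub (j₁ k j)
    rw [integral_add j₂₁ (j₃ k j), integral_sub (j₂ k j) (j₁ k j), ibp₁, ibp₂]
    ring
  have keyint : ∀ k j, Integrable (fun z =>
      ((virialW M k z : ℂ) * (conj ((∂_{antiV j} (F j)) z) * F k z) -
      (virialW M k z : ℂ) * (conj (Ψ z) * (∂_{diagV j} (∂_{antiV j} (F k))) z) +
      ((2 * virialH M k j z : ℝ) : ℂ) * (conj (F j z) * F k z))) := fun k j =>
    ((j₂ k j).sub (j₁ k j)).add (j₃ k j)
  have hsum : ∫ z, ∑ k, ∑ j, ((virialW M k z : ℂ) * (conj ((∂_{antiV j} (F j)) z) * F k z) -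
      (virialW M k z : ℂ) * (conj (Ψ z) * (∂_{diagV j} (∂_{antiV j} (F k))) z) +
      ((2 * virialH M k j z : ℝ) : ℂ) * (conj (F j z) * F k z)) = 0 := by
    rw [integral_finsetSum _ fun k _ => integrable_finsetSum _ fun j _ => keyint k j]
    refine Finset.sum_eq_zero fun k _ => ?_
    rw [integral_finsetSum _ fun j _ => keyint k j]
    exact Finset.sum_eq_zero fun j _ => key k j
  have hI := integrable_finsetSum Finset.univ fun k _ =>
    integrable_finsetSum Finset.univ fun j _ => keyint k j
  have hR : Integrable (fun z => ((∑ k, (virialW M k z * relC k z : ℂ)) * (conj (Ψ z) * Ψ z) -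
      ∑ k, ∑ j, (virialH M k j z : ℂ) * (conj (F j z) * F k z))) := by
    simp only [Finset.sum_mul]
    exact (integrable_finsetSum _ fun k _ => integrable_virialW_mul_relC hM k Ψ).sub
      (integrable_finsetSum _ fun k _ => integrable_finsetSum _ fun j _ =>
        integrable_virialH_mul hM k j _ _)
  have h := integral_add (hR.const_mul (2 * I)) (hI.const_mul I)
  rw [integral_const_mul I, hsum, mul_zero, add_zero, integral_const_mul] at h
  refine (integral_congr_ae (Eventually.of_forall fun z => ?_)).trans h
  simp only [tensL_apply, lineDerivOp_diagV_tensL_apply, ← hΨ]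
  simp only [hF, Fin.sum_univ_two, map_mul, map_add, map_sub, map_neg, conj_I, map_pow,
    conj_ofReal, ofReal_mul, ofReal_ofNat]
  ring

section Bounds

theorem integrable_norm_mul_norm (f g : 𝓢(E2, ℂ)) : Integrable fun x => ‖f x‖ * ‖g x‖ :=
  (integrable_conj_mul f g).norm.congr (Eventually.of_forall fun x => by simp)

theorem integral_norm_mul_norm_le (f g : 𝓢(E2, ℂ)) :
    ∫ x, ‖f x‖ * ‖g x‖ ≤ √(mass f) * √(mass g) := by
  have h := integral_mul_le_Lp_mul_Lq_of_nonneg (μ := (volume : Measure E2))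
    (p := 2) (q := 2) Real.HolderConjugate.two_two
    (f := fun x => ‖f x‖) (g := fun x => ‖g x‖)
    (Eventually.of_forall fun _ => norm_nonneg _) (Eventually.of_forall fun _ => norm_nonneg _)
    (by simpa using (f.memLp 2).norm) (by simpa using (g.memLp 2).norm)
  simpa [mass, Real.sqrt_eq_rpow] using h

theorem mass_lineDerivOp_le (k : Fin 2) (f : 𝓢(E2, ℂ)) : mass (∂_{coordVec k} f : 𝓢(E2, ℂ)) ≤ energy f := by
  have h : mass (∂_{coordVec k} f : 𝓢(E2, ℂ)) ≤ ∫ x, gradSq f x := by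
    refine integral_mono (integrable_norm_sq _) (integrable_gradSq f) fun x => ?_
    exact Finset.single_le_sum (f := fun i => ‖pd i f x‖ ^ 2) (fun _ _ => by positivity)
      (Finset.mem_univ k)
  have h' : 0 ≤ ∫ x, ‖x‖ ^ 2 * ‖f x‖ ^ 2 := integral_nonneg fun x => by positivity
  unfold energy
  linarith

/-- Multiplication of a Schwartz function by a coordinate. -/
def coordMul (k : Fin 2) (f : 𝓢(E2, ℂ)) : 𝓢(E2, ℂ) := smulLeftCLM ℂ (fun x : E2 => (x k : ℂ)) f

@[simp]
theorem coordMul_apply (k : Fin 2) (f : 𝓢(E2, ℂ)) (x : E2) : coordMul k f x = (x k : ℂ) * f x :=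
  smulLeftCLM_apply_apply (ofRealCLM ∘L (EuclideanSpace.proj k : E2 →L[ℝ] ℝ)).hasTemperateGrowth f x

theorem mass_coordMul_le (k : Fin 2) (f : 𝓢(E2, ℂ)) : mass (coordMul k f) ≤ energy f := by
  have h : mass (coordMul k f) ≤ ∫ x, ‖x‖ ^ 2 * ‖f x‖ ^ 2 := by
    refine integral_mono (integrable_norm_sq _) (integrable_norm_sq_mul_norm_sq f) fun x => ?_
    simp only [coordMul_apply, norm_mul, norm_real, mul_pow]
    gcongr
    exact PiLp.norm_apply_le x k
  have h' : 0 ≤ ∫ x, gradSq f x := integral_nonneg fun x => by unfold gradSq; positivity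
  unfold energy
  linarith

theorem mass_conjS (f : 𝓢(E2, ℂ)) : mass (conjS f) = mass f := by simp [mass]

theorem energy_conjS (f : 𝓢(E2, ℂ)) : energy (conjS f) = energy f := by
  simp [energy, gradSq, pd_eq_lineDerivOp, lineDerivOp_conjS]

/-- The right-hand side of the bilinear estimate on a time slice. -/
def bilin (φ χ : 𝓢(E2, ℂ)) : ℝ :=
  √(mass χ) ^ 2 * √(mass φ) * √(energy φ) + √(mass φ) ^ 2 * √(mass χ) * √(energy χ)

theorem bilin_nonneg (φ χ : 𝓢(E2, ℂ)) : 0 ≤ bilin φ χ := by unfold bilin; positivity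

/-- The density controlled by `bilin`. -/
def bilinDensity (φ χ D D' : 𝓢(E2, ℂ)) (z : E2 × E2) : ℝ :=
  (‖φ z.1‖ * ‖D z.1‖) * ‖χ z.2‖ ^ 2 + ‖φ z.1‖ ^ 2 * (‖χ z.2‖ * ‖D' z.2‖)

theorem integrable_bilinDensity (φ χ D D' : 𝓢(E2, ℂ)) : Integrable (bilinDensity φ χ D D') :=
  ((integrable_norm_mul_norm φ D).mul_prod (integrable_norm_sq χ)).add
    ((integrable_norm_sq φ).mul_prod (integrable_norm_mul_norm χ D'))

theorem integral_bilinDensity_le {φ χ D D' : 𝓢(E2, ℂ)} (hD : mass D ≤ energy φ)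
    (hD' : mass D' ≤ energy χ) : ∫ z, bilinDensity φ χ D D' z ≤ bilin φ χ := by
  unfold bilinDensity
  rw [Measure.volume_eq_prod, integral_add
    ((integrable_norm_mul_norm φ D).mul_prod (integrable_norm_sq χ))
    ((integrable_norm_sq φ).mul_prod (integrable_norm_mul_norm χ D')),
    integral_prod_mul (fun x => ‖φ x‖ * ‖D x‖) (fun y => ‖χ y‖ ^ 2),
    integral_prod_mul (fun x => ‖φ x‖ ^ 2) (fun y => ‖χ y‖ * ‖D' y‖)]
  change _ * mass χ + mass φ * _ ≤ _
  have h₁ := integral_norm_mul_norm_le φ D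
  have h₂ := integral_norm_mul_norm_le χ D'
  unfold bilin
  rw [Real.sq_sqrt (mass_nonneg χ), Real.sq_sqrt (mass_nonneg φ), mul_assoc, mul_assoc,
    mul_comm (mass χ)]
  refine add_le_add (mul_le_mul_of_nonneg_right (h₁.trans ?_) (mass_nonneg χ))
    (mul_le_mul_of_nonneg_left (h₂.trans ?_) (mass_nonneg φ)) <;> gcongr

theorem lineDerivOp_diagV_tens_apply (k : Fin 2) (φ χ : 𝓢(E2, ℂ)) (z : E2 × E2) :
    (∂_{diagV k} (tens φ χ)) z =
      (∂_{coordVec k} φ) z.1 * χ z.2 + φ z.1 * (∂_{coordVec k} χ) z.2 := by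
  rw [lineDerivOp_diagV_tens]; rfl

/-- The virial functional density. -/
def virialP (M : ℝ) (φ χ : 𝓢(E2, ℂ)) (z : E2 × E2) : ℂ :=
  ∑ k, (virialW M k z : ℂ) * (conj (tens φ χ z) * (∂_{diagV k} (tens φ χ)) z)

/-- The time derivative of the virial functional density. -/
def virialP' (M : ℝ) (φ χ : 𝓢(E2, ℂ)) (z : E2 × E2) : ℂ :=
  ∑ k, (virialW M k z : ℂ) * (conj (I * tensL φ χ z) * (∂_{diagV k} (tens φ χ)) z +
      conj (tens φ χ z) * (I * (∂_{diagV k} (tensL φ χ)) z))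

/-- The virial weight applied to the mass density. -/
def virialY (M : ℝ) (φ χ : 𝓢(E2, ℂ)) (z : E2 × E2) : ℝ :=
  (∑ k, virialW M k z * relC k z) * ‖tens φ χ z‖ ^ 2

/-- The coercive virial density. -/
def virialX (M : ℝ) (φ χ : 𝓢(E2, ℂ)) (z : E2 × E2) : ℝ :=
  invDist M z * ∑ k, ‖(∂_{diagV k} (tens φ χ)) z‖ ^ 2 -
    invDist M z ^ 3 * ‖∑ k, (relC k z : ℂ) * (∂_{diagV k} (tens φ χ)) z‖ ^ 2

variable {M : ℝ} (hM : 0 < M) (φ χ : 𝓢(E2, ℂ))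

include hM

theorem integrable_virialP : Integrable (virialP M φ χ) :=
  integrable_finsetSum _ fun k _ =>
    integrable_weight_mul (continuous_virialW hM k) (fun z => abs_virialW_le hM z k) _ _

theorem norm_integral_virialP_le : ‖∫ z, virialP M φ χ z‖ ≤ 2 * bilin φ χ := by
  calc ‖∫ z, virialP M φ χ z‖ ≤ ∫ z, ∑ k, bilinDensity φ χ (∂_{coordVec k} φ) (∂_{coordVec k} χ) z := by
        refine norm_integral_le_of_norm_le
          (integrable_finsetSum _ fun k _ => integrable_bilinDensity _ _ _ _)
          (Eventually.of_forall fun z => ?_)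
        refine norm_sum_le_of_le _ fun k _ => ?_
        rw [norm_mul, norm_real, Real.norm_eq_abs]
        refine (mul_le_of_le_one_left (norm_nonneg _) (abs_virialW_le hM z k)).trans ?_
        rw [norm_mul, RCLike.norm_conj, lineDerivOp_diagV_tens_apply, tens_apply]
        refine (mul_le_mul_of_nonneg_left (norm_add_le _ _) (norm_nonneg _)).trans (le_of_eq ?_)
        simp only [norm_mul, bilinDensity]
        ring
    _ = ∑ k, ∫ z, bilinDensity φ χ (∂_{coordVec k} φ) (∂_{coordVec k} χ) z :=
        integral_finsetSum _ fun k _ => integrable_bilinDensity _ _ _ _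
    _ ≤ ∑ _k : Fin 2, bilin φ χ := Finset.sum_le_sum fun k _ =>
        integral_bilinDensity_le (mass_lineDerivOp_le k φ) (mass_lineDerivOp_le k χ)
    _ = 2 * bilin φ χ := by simp

theorem integrable_virialY : Integrable (virialY M φ χ) := by
  refine (integrable_finsetSum Finset.univ
    fun k _ => integrable_virialW_mul_relC hM k (tens φ χ)).re.congr
    (Eventually.of_forall fun z => ?_)
  simp only [← Finset.sum_mul, ← normSq_eq_conj_mul_self, virialY, ← normSq_eq_norm_sq]
  norm_cast

theorem integral_virialY_le : ∫ z, virialY M φ χ z ≤ 2 * bilin φ χ := by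
  calc ∫ z, virialY M φ χ z ≤ ∫ z, ∑ k, bilinDensity φ χ (coordMul k φ) (coordMul k χ) z := by
        refine integral_mono (integrable_virialY hM φ χ)
          (integrable_finsetSum _ fun k _ => integrable_bilinDensity _ _ _ _) fun z => ?_
        simp only [virialY, Finset.sum_mul]
        refine Finset.sum_le_sum fun k _ => ?_
        have h : virialW M k z * relC k z ≤ ‖z.1 k‖ + ‖z.2 k‖ := by
          refine (le_abs_self _).trans ?_
          rw [abs_mul]
          exact (mul_le_of_le_one_left (abs_nonneg _) (abs_virialW_le hM z k)).trans
            (norm_sub_le (z.1 k) (z.2 k))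
        refine (mul_le_mul_of_nonneg_right h (by positivity)).trans (le_of_eq ?_)
        simp only [tens_apply, bilinDensity, coordMul_apply, norm_mul, norm_real]
        ring
    _ = ∑ k, ∫ z, bilinDensity φ χ (coordMul k φ) (coordMul k χ) z :=
        integral_finsetSum _ fun k _ => integrable_bilinDensity _ _ _ _
    _ ≤ ∑ _k : Fin 2, bilin φ χ := Finset.sum_le_sum fun k _ =>
        integral_bilinDensity_le (mass_coordMul_le k φ) (mass_coordMul_le k χ)
    _ = 2 * bilin φ χ := by simp

omit hM in
theorem ofReal_virialX (z : E2 × E2) : (virialX M φ χ z : ℂ) = ∑ k, ∑ j, (virialH M k j z : ℂ) *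
    (conj ((∂_{diagV j} (tens φ χ)) z) * (∂_{diagV k} (tens φ χ)) z) := by
  have h := virialH_quadratic (M := M) z fun k => (∂_{diagV k} (tens φ χ)) z
  rw [h, virialX]

omit hM in
theorem ofReal_virialY (z : E2 × E2) : (virialY M φ χ z : ℂ) =
    (∑ k, (virialW M k z * relC k z : ℂ)) * (conj (tens φ χ z) * tens φ χ z) := by
  rw [← normSq_eq_conj_mul_self, virialY, ← normSq_eq_norm_sq]
  push_cast
  rfl

theorem integrable_virialX : Integrable (virialX M φ χ) := by
  refine (integrable_finsetSum Finset.univ fun k _ => integrable_finsetSum Finset.univ fun j _ =>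
    integrable_virialH_mul hM k j (∂_{diagV j} (tens φ χ)) (∂_{diagV k} (tens φ χ))).re.congr
    (Eventually.of_forall fun z => ?_)
  simp only [← ofReal_virialX, RCLike.re_to_complex, ofReal_re]

theorem integral_virialP' : ∫ z, virialP' M φ χ z =
    2 * I * (((∫ z, virialY M φ χ z) - ∫ z, virialX M φ χ z : ℝ) : ℂ) := by
  rw [← integral_sub (integrable_virialY hM φ χ) (integrable_virialX hM φ χ),
    ← integral_complex_ofReal]
  simp only [ofReal_sub, ofReal_virialX, ofReal_virialY]
  exact virial_identity hM φ χ

theorem integrable_virialP' : Integrable (virialP' M φ χ) := by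
  refine integrable_finsetSum _ fun k _ => ?_
  have h₁ := integrable_weight_mul (continuous_virialW hM k) (fun z => abs_virialW_le hM z k)
    (I • tensL φ χ) (∂_{diagV k} (tens φ χ)) (μ := volume)
  have h₂ := integrable_weight_mul (continuous_virialW hM k) (fun z => abs_virialW_le hM z k)
    (tens φ χ) (I • ∂_{diagV k} (tensL φ χ)) (μ := volume)
  refine (h₁.add h₂).congr (Eventually.of_forall fun z => ?_)
  simp only [Pi.add_apply, smul_apply, smul_eq_mul]
  ring

end Bounds

section TimeDerivativeBound

/-- The square density of the third order norm built from the oscillator. -/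
def sqDensity (φ : 𝓢(E2, ℂ)) (x : E2) : ℝ :=
  ‖φ x‖ ^ 2 + ∑ k, ‖(∂_{coordVec k} φ) x‖ ^ 2 + ‖harm φ x‖ ^ 2 +
    ∑ k, ‖(∂_{coordVec k} (harm φ)) x‖ ^ 2

theorem sqDensity_nonneg (φ : 𝓢(E2, ℂ)) (x : E2) : 0 ≤ sqDensity φ x := by
  unfold sqDensity; positivity

/-- A bound for the integral of `sqDensity` in terms of conserved quantities. -/
def sqBound (φ : 𝓢(E2, ℂ)) : ℝ := mass φ + energy φ + mass (harm φ) + energy (harm φ)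

theorem integrable_sqDensity (φ : 𝓢(E2, ℂ)) : Integrable (sqDensity φ) :=
  (((integrable_norm_sq φ).add (integrable_gradSq φ)).add (integrable_norm_sq (harm φ))).add
    (integrable_gradSq (harm φ))

theorem integral_gradSq_le_energy (φ : 𝓢(E2, ℂ)) : ∫ x, gradSq φ x ≤ energy φ :=
  le_add_of_nonneg_right (integral_nonneg fun x => by positivity)

theorem integral_sqDensity_le (φ : 𝓢(E2, ℂ)) : ∫ x, sqDensity φ x ≤ sqBound φ := by
  have i₁ := integrable_norm_sq (μ := volume) φ
  have i₂ := integrable_gradSq φ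
  have i₃ := integrable_norm_sq (μ := volume) (harm φ)
  have i₄ := integrable_gradSq (harm φ)
  have h : ∫ x, sqDensity φ x = mass φ + (∫ x, gradSq φ x) + mass (harm φ) +
      ∫ x, gradSq (harm φ) x := by
    have i₁₂ : Integrable (fun x => ‖φ x‖ ^ 2 + gradSq φ x) := i₁.add i₂
    have i₁₂₃ : Integrable (fun x => ‖φ x‖ ^ 2 + gradSq φ x + ‖harm φ x‖ ^ 2) := i₁₂.add i₃
    rw [mass, mass, ← integral_add i₁ i₂, ← integral_add i₁₂ i₃, ← integral_add i₁₂₃ i₄]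
    rfl
  rw [h, sqBound]
  linarith [integral_gradSq_le_energy φ, integral_gradSq_le_energy (harm φ)]

/-- The sum of the norms whose squares enter `sqDensity`. -/
def normSum (φ : 𝓢(E2, ℂ)) (x : E2) : ℝ :=
  ‖φ x‖ + ∑ k, ‖(∂_{coordVec k} φ) x‖ + ‖harm φ x‖ + ∑ k, ‖(∂_{coordVec k} (harm φ)) x‖

theorem normSum_sq_le (φ : 𝓢(E2, ℂ)) (x : E2) : normSum φ x ^ 2 ≤ 6 * sqDensity φ x := by
  unfold normSum sqDensity
  simp only [Fin.sum_univ_two]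
  generalize ‖φ x‖ = a
  generalize ‖(∂_{coordVec 0} φ) x‖ = b
  generalize ‖(∂_{coordVec 1} φ) x‖ = c
  generalize ‖harm φ x‖ = d
  generalize ‖(∂_{coordVec 0} (harm φ)) x‖ = e
  generalize ‖(∂_{coordVec 1} (harm φ)) x‖ = f
  have h := sq_sum_le_card_mul_sum_sq (s := Finset.univ) (f := ![a, b, c, d, e, f])
  simp [Fin.sum_univ_succ] at h
  linarith

theorem lineDerivOp_diagV_tensL_eq (k : Fin 2) (φ χ : 𝓢(E2, ℂ)) (z : E2 × E2) :
    (∂_{diagV k} (tensL φ χ)) z =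
      ((∂_{coordVec k} (harm φ)) z.1 * χ z.2 + harm φ z.1 * (∂_{coordVec k} χ) z.2) -
      ((∂_{coordVec k} φ) z.1 * harm χ z.2 + φ z.1 * (∂_{coordVec k} (harm χ)) z.2) := by
  rw [tensL, schwartz_lineDerivOp_sub, sub_apply, lineDerivOp_diagV_tens_apply,
    lineDerivOp_diagV_tens_apply]

theorem norm_virialP'_le {M : ℝ} (hM : 0 < M) (φ χ : 𝓢(E2, ℂ)) (z : E2 × E2) :
    ‖virialP' M φ χ z‖ ≤ 144 * (sqDensity φ z.1 * sqDensity χ z.2) := by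
  have e₁ : ∀ k, ‖(∂_{coordVec k} φ) z.1‖ ≤ ∑ k, ‖(∂_{coordVec k} φ) z.1‖ := fun k =>
    Finset.single_le_sum (f := fun k => ‖(∂_{coordVec k} φ) z.1‖) (fun _ _ => norm_nonneg _)
      (Finset.mem_univ k)
  have e₂ : ∀ k, ‖(∂_{coordVec k} χ) z.2‖ ≤ ∑ k, ‖(∂_{coordVec k} χ) z.2‖ := fun k =>
    Finset.single_le_sum (f := fun k => ‖(∂_{coordVec k} χ) z.2‖) (fun _ _ => norm_nonneg _)
      (Finset.mem_univ k)
  have e₃ : ∀ k, ‖(∂_{coordVec k} (harm φ)) z.1‖ ≤ ∑ k, ‖(∂_{coordVec k} (harm φ)) z.1‖ := fun k =>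
    Finset.single_le_sum (f := fun k => ‖(∂_{coordVec k} (harm φ)) z.1‖)
      (fun _ _ => norm_nonneg _) (Finset.mem_univ k)
  have e₄ : ∀ k, ‖(∂_{coordVec k} (harm χ)) z.2‖ ≤ ∑ k, ‖(∂_{coordVec k} (harm χ)) z.2‖ := fun k =>
    Finset.single_le_sum (f := fun k => ‖(∂_{coordVec k} (harm χ)) z.2‖)
      (fun _ _ => norm_nonneg _) (Finset.mem_univ k)
  have b₁' : ‖tens φ χ z‖ = ‖φ z.1‖ * ‖χ z.2‖ := norm_mul _ _
  have b₂' : ∀ k, ‖(∂_{diagV k} (tens φ χ)) z‖ ≤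
      ‖(∂_{coordVec k} φ) z.1‖ * ‖χ z.2‖ + ‖φ z.1‖ * ‖(∂_{coordVec k} χ) z.2‖ := fun k => by
    rw [lineDerivOp_diagV_tens_apply, ← norm_mul, ← norm_mul]
    exact norm_add_le _ _
  have b₃' : ‖tensL φ χ z‖ ≤ ‖harm φ z.1‖ * ‖χ z.2‖ + ‖φ z.1‖ * ‖harm χ z.2‖ := by
    rw [← norm_mul, ← norm_mul]
    exact norm_sub_le _ _
  have b₄' : ∀ k, ‖(∂_{diagV k} (tensL φ χ)) z‖ ≤
      (‖(∂_{coordVec k} (harm φ)) z.1‖ * ‖χ z.2‖ + ‖harm φ z.1‖ * ‖(∂_{coordVec k} χ) z.2‖) +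
      (‖(∂_{coordVec k} φ) z.1‖ * ‖harm χ z.2‖ + ‖φ z.1‖ * ‖(∂_{coordVec k} (harm χ)) z.2‖) :=
    fun k => by
      rw [lineDerivOp_diagV_tensL_eq]
      simp only [← norm_mul]
      exact (norm_sub_le _ _).trans (add_le_add (norm_add_le _ _) (norm_add_le _ _))
  set N := normSum φ z.1 * normSum χ z.2 with hN
  simp only [normSum] at hN
  have p₁ := norm_nonneg (φ z.1)
  have p₂ := norm_nonneg (χ z.2)
  have p₃ := norm_nonneg (harm φ z.1)
  have p₄ := norm_nonneg (harm χ z.2)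
  have p₅ := (norm_nonneg _).trans (e₁ 0)
  have p₆ := (norm_nonneg _).trans (e₂ 0)
  have p₇ := (norm_nonneg _).trans (e₃ 0)
  have p₈ := (norm_nonneg _).trans (e₄ 0)
  generalize ∑ k, ‖(∂_{coordVec k} φ) z.1‖ = B at *
  generalize ∑ k, ‖(∂_{coordVec k} χ) z.2‖ = B' at *
  generalize ∑ k, ‖(∂_{coordVec k} (harm φ)) z.1‖ = D at *
  generalize ∑ k, ‖(∂_{coordVec k} (harm χ)) z.2‖ = D' at *
  have b₁ : ‖tens φ χ z‖ ≤ N := by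
    rw [b₁', hN, ← sub_nonneg]
    ring_nf
    positivity
  have b₂ : ∀ k, ‖(∂_{diagV k} (tens φ χ)) z‖ ≤ N := fun k => by
    refine (b₂' k).trans ((add_le_add (mul_le_mul_of_nonneg_right (e₁ k) p₂)
      (mul_le_mul_of_nonneg_left (e₂ k) p₁)).trans ?_)
    rw [hN, ← sub_nonneg]
    ring_nf
    positivity
  have b₃ : ‖tensL φ χ z‖ ≤ N := by
    refine b₃'.trans ?_
    rw [hN, ← sub_nonneg]
    ring_nf
    positivity
  have b₄ : ∀ k, ‖(∂_{diagV k} (tensL φ χ)) z‖ ≤ N := fun k => by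
    refine (b₄' k).trans ((add_le_add (add_le_add (mul_le_mul_of_nonneg_right (e₃ k) p₂)
      (mul_le_mul_of_nonneg_left (e₂ k) p₃)) (add_le_add (mul_le_mul_of_nonneg_right (e₁ k) p₄)
      (mul_le_mul_of_nonneg_left (e₄ k) p₁))).trans ?_)
    rw [hN, ← sub_nonneg]
    ring_nf
    positivity
  have hN0 : 0 ≤ N := (norm_nonneg _).trans b₁
  have hN2 : N ^ 2 ≤ 36 * (sqDensity φ z.1 * sqDensity χ z.2) := by
    change (normSum φ z.1 * normSum χ z.2) ^ 2 ≤ _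
    rw [mul_pow]
    refine (mul_le_mul (normSum_sq_le φ z.1) (normSum_sq_le χ z.2) (by positivity)
      (mul_nonneg (by norm_num) (sqDensity_nonneg _ _))).trans (le_of_eq (by ring))
  have hk : ∀ k, ‖(virialW M k z : ℂ) * (conj (I * tensL φ χ z) * (∂_{diagV k} (tens φ χ)) z +
      conj (tens φ χ z) * (I * (∂_{diagV k} (tensL φ χ)) z))‖ ≤ N * N + N * N := by
    intro k
    rw [norm_mul, norm_real, Real.norm_eq_abs]
    refine (mul_le_of_le_one_left (norm_nonneg _) (abs_virialW_le hM z k)).trans ?_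
    refine norm_add_le_of_le ?_ ?_ <;> simp only [norm_mul, RCLike.norm_conj, norm_I, one_mul]
    · exact mul_le_mul b₃ (b₂ k) (norm_nonneg _) hN0
    · exact mul_le_mul b₁ (b₄ k) (norm_nonneg _) hN0
  refine (norm_sum_le_of_le _ fun k _ => hk k).trans ?_
  simp only [Finset.sum_const, Finset.card_univ, Fintype.card_fin, nsmul_eq_mul]
  push_cast
  linarith

theorem integral_norm_virialP'_le {M : ℝ} (hM : 0 < M) (φ χ : 𝓢(E2, ℂ)) :
    ∫ z, ‖virialP' M φ χ z‖ ≤ 144 * (sqBound φ * sqBound χ) := by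
  have hi : Integrable (fun z : E2 × E2 => sqDensity φ z.1 * sqDensity χ z.2) :=
    (integrable_sqDensity φ).mul_prod (integrable_sqDensity χ)
  refine (integral_mono (integrable_virialP' hM φ χ).norm (hi.const_mul 144)
    (norm_virialP'_le hM φ χ)).trans ?_
  rw [integral_const_mul, Measure.volume_eq_prod, integral_prod_mul]
  have h₁ := integral_sqDensity_le φ
  have h₂ := integral_sqDensity_le χ
  have h₃ : 0 ≤ ∫ x, sqDensity χ x := integral_nonneg (sqDensity_nonneg χ)
  have h₄ : 0 ≤ ∫ x, sqDensity φ x := integral_nonneg (sqDensity_nonneg φ)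
  gcongr
  exact h₄.trans h₁

end TimeDerivativeBound

section TimeDependent

variable {u v : ℝ → 𝓢(E2, ℂ)}

theorem IsLinSolution.hasDerivAt_tens (hu : IsLinSolution u) (hv : IsLinSolution v) (t : ℝ)
    (z : E2 × E2) : HasDerivAt (fun s => tens (u s) (conjS (v s)) z)
      (I * tensL (u t) (conjS (v t)) z) t := by
  have h := (hu.hasDerivAt t z.1).fun_mul (hv.hasDerivAt t z.2).star
  refine (h.congr_deriv ?_).congr_of_eventuallyEq (Eventually.of_forall fun s => ?_)
  · simp only [tensL, harm_conjS, sub_apply, tens_apply, conjS_apply, star_mul, star_def, conj_I]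
    ring
  · simp

theorem IsLinSolution.hasDerivAt_lineDerivOp_tens (hu : IsLinSolution u) (hv : IsLinSolution v)
    (k : Fin 2) (t : ℝ) (z : E2 × E2) :
    HasDerivAt (fun s => (∂_{diagV k} (tens (u s) (conjS (v s)))) z)
      (I * (∂_{diagV k} (tensL (u t) (conjS (v t)))) z) t := by
  have h := ((hu.hasDerivAt_pd k t z.1).fun_mul (hv.hasDerivAt t z.2).star).fun_add
    ((hu.hasDerivAt t z.1).fun_mul (hv.hasDerivAt_pd k t z.2).star)
  simp only [pd_eq_lineDerivOp] at h
  refine (h.congr_deriv ?_).congr_of_eventuallyEq (Eventually.of_forall fun s => ?_)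
  · simp only [lineDerivOp_diagV_tensL_eq, harm_conjS, lineDerivOp_conjS, conjS_apply, star_mul,
      star_def, conj_I]
    ring
  · simp [lineDerivOp_diagV_tens_apply, lineDerivOp_conjS]

theorem IsLinSolution.hasDerivAt_virialP (hu : IsLinSolution u) (hv : IsLinSolution v) (M t : ℝ)
    (z : E2 × E2) : HasDerivAt (fun s => virialP M (u s) (conjS (v s)) z)
      (virialP' M (u t) (conjS (v t)) z) t := by
  unfold virialP virialP'
  refine HasDerivAt.fun_sum fun k _ => HasDerivAt.const_mul _ ?_
  exact (hu.hasDerivAt_tens hv t z).star.fun_mul (hu.hasDerivAt_lineDerivOp_tens hv k t z)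

theorem IsLinSolution.continuous_virialP' (hu : IsLinSolution u) (hv : IsLinSolution v) {M : ℝ}
    (hM : 0 < M) : Continuous (Function.uncurry fun t z => virialP' M (u t) (conjS (v t)) z) := by
  have c₁ : Continuous fun p : ℝ × (E2 × E2) => (p.1, p.2.1) := by fun_prop
  have c₂ : Continuous fun p : ℝ × (E2 × E2) => (p.1, p.2.2) := by fun_prop
  have u₁ := hu.continuous.comp c₁
  have u₂ := hu.harm_comp.continuous.comp c₁
  have u₃ := fun k => (hu.continuous_pd k).comp c₁
  have u₄ := fun k => (hu.harm_comp.continuous_pd k).comp c₁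
  have v₁ := hv.continuous.comp c₂
  have v₂ := hv.harm_comp.continuous.comp c₂
  have v₃ := fun k => (hv.continuous_pd k).comp c₂
  have v₄ := fun k => (hv.harm_comp.continuous_pd k).comp c₂
  have w := fun k => (continuous_virialW hM k).comp
    (continuous_snd : Continuous fun p : ℝ × (E2 × E2) => p.2)
  simp only [pd_eq_lineDerivOp, Function.comp_def] at u₁ u₂ u₃ u₄ v₁ v₂ v₃ v₄ w
  simp only [Function.uncurry_def, virialP', lineDerivOp_diagV_tensL_eq]
  simp only [tensL, sub_apply, tens_apply, lineDerivOp_diagV_tens_apply, harm_conjS,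
    lineDerivOp_conjS, conjS_apply]
  refine continuous_finsetSum _ fun k _ => ?_
  have v₁' := continuous_conj.comp v₁
  have v₂' := continuous_conj.comp v₂
  have v₃' := continuous_conj.comp (v₃ k)
  have v₄' := continuous_conj.comp (v₄ k)
  exact (continuous_ofReal.comp (w k)).mul
    (((continuous_conj.comp (continuous_const.mul ((u₂.mul v₁').sub (u₁.mul v₂')))).mul
      (((u₃ k).mul v₁').add (u₁.mul v₃'))).add
    ((continuous_conj.comp (u₁.mul v₁')).mul (continuous_const.mul
      ((((u₄ k).mul v₁').add (u₂.mul v₃')).sub (((u₃ k).mul v₂').add (u₁.mul v₄'))))))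

theorem IsLinSolution.sqBound_eq (hu : IsLinSolution u) (s t : ℝ) :
    sqBound (u s) = sqBound (u t) := by
  obtain ⟨h₁, h₂, h₃⟩ := hu.conserved s t
  obtain ⟨-, h₄, -⟩ := hu.harm_comp.conserved s t
  simp only [sqBound, h₁, h₂, h₃, h₄]

theorem sqBound_conjS (φ : 𝓢(E2, ℂ)) : sqBound (conjS φ) = sqBound φ := by
  simp only [sqBound, harm_conjS, mass_conjS, energy_conjS]

theorem bilin_conjS (φ χ : 𝓢(E2, ℂ)) : bilin φ (conjS χ) = bilin φ χ := by
  simp only [bilin, mass_conjS, energy_conjS]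

theorem IsLinSolution.bilin_eq (hu : IsLinSolution u) (hv : IsLinSolution v) (s t : ℝ) :
    bilin (u s) (v s) = bilin (u t) (v t) := by
  obtain ⟨h₁, h₂, -⟩ := hu.conserved s t
  obtain ⟨h₃, h₄, -⟩ := hv.conserved s t
  simp only [bilin, h₁, h₂, h₃, h₄]

/-- The virial quantity, integrated in time. -/
theorem IsLinSolution.integral_virial_le (hu : IsLinSolution u) (hv : IsLinSolution v) {M T : ℝ}
    (hM : 0 < M) (hT : 0 ≤ T) :
    IntervalIntegrable (fun t => (∫ z, virialX M (u t) (conjS (v t)) z) -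
      ∫ z, virialY M (u t) (conjS (v t)) z) volume 0 T ∧
    ∫ t in (0 : ℝ)..T, ((∫ z, virialX M (u t) (conjS (v t)) z) -
      ∫ z, virialY M (u t) (conjS (v t)) z) ≤ 2 * bilin (u 0) (v 0) := by
  obtain ⟨h₁, h₂⟩ := integral_sub_eq_of_hasDerivAt (μ := volume)
    (P := fun t => virialP M (u t) (conjS (v t))) (P' := fun t => virialP' M (u t) (conjS (v t)))
    (K := 144 * (sqBound (u 0) * sqBound (v 0))) hT (hu.continuous_virialP' hv hM)
    (hu.hasDerivAt_virialP hv M) (fun t => integrable_virialP hM _ _)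
    (fun t => integrable_virialP' hM _ _) (fun t _ => by
      rw [hu.sqBound_eq 0 t, hv.sqBound_eq 0 t, ← sqBound_conjS (v t)]
      exact integral_norm_virialP'_le hM _ _)
  have e : ∀ t, ((((∫ z, virialX M (u t) (conjS (v t)) z) -
      ∫ z, virialY M (u t) (conjS (v t)) z : ℝ)) : ℂ) =
      (I / 2) * ∫ z, virialP' M (u t) (conjS (v t)) z := by
    intro t
    rw [integral_virialP' hM]
    push_cast
    linear_combination (-1 : ℂ) * ((∫ z, virialY M (u t) (conjS (v t)) z : ℝ) -
      (∫ z, virialX M (u t) (conjS (v t)) z : ℝ)) * I_sq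
  have hZ := h₁.const_mul (I / 2)
  simp only [← e] at hZ
  have hZ' : IntervalIntegrable (fun t => (∫ z, virialX M (u t) (conjS (v t)) z) -
      ∫ z, virialY M (u t) (conjS (v t)) z) volume 0 T :=
    ⟨hZ.1.re, hZ.2.re⟩
  refine ⟨hZ', ?_⟩
  have h₃ := intervalIntegral.integral_const_mul (I / 2)
    (fun t => ∫ z, virialP' M (u t) (conjS (v t)) z) (a := 0) (b := T) (μ := volume)
  simp only [← e] at h₃
  rw [h₂, intervalIntegral.integral_ofReal] at h₃
  have h₄ := congrArg norm h₃
  rw [norm_real, norm_mul, norm_div, norm_I, RCLike.norm_ofNat] at h₄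
  have h₅ : ∀ t, ‖∫ z, virialP M (u t) (conjS (v t)) z‖ ≤ 2 * bilin (u 0) (v 0) := fun t => by
    rw [hu.bilin_eq hv 0 t, ← bilin_conjS]
    exact norm_integral_virialP_le hM _ _
  have h₆ := (norm_sub_le (∫ z, virialP M (u T) (conjS (v T)) z)
    (∫ z, virialP M (u 0) (conjS (v 0)) z)).trans (add_le_add (h₅ T) (h₅ 0))
  refine (le_abs_self _).trans ?_
  rw [← Real.norm_eq_abs, h₄]
  linarith

end TimeDependent

theorem virialX_coercive {M : ℝ} (hM : 0 < M) (φ χ : 𝓢(E2, ℂ)) (z : E2 × E2) :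
    0 ≤ virialX M φ χ z ∧ (∑ i, relC i z ^ 2 < (M⁻¹) ^ 2 →
      M * ∑ k, ‖(∂_{diagV k} (tens φ χ)) z‖ ^ 2 ≤ 3 * virialX M φ χ z) := by
  have h := virialH_coercive hM z fun k => (∂_{diagV k} (tens φ χ)) z
  unfold virialX
  exact h

theorem setIntegral_le_virialX {M : ℝ} (hM : 0 < M) (φ ψ : 𝓢(E2, ℂ)) :
    ∫ q in {q : E2 × E2 | ‖q.1 - q.2‖ < 1 / M}, M * ∑ k : Fin 2,
      ‖φ q.1 * pd k (fun z => conj (ψ z)) q.2 + conj (ψ q.2) * pd k (fun z => φ z) q.1‖ ^ 2 ≤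
    3 * ∫ z, virialX M φ (conjS ψ) z := by
  have hX := (integrable_virialX hM φ (conjS ψ)).const_mul 3
  have hX0 : ∀ z, 0 ≤ 3 * virialX M φ (conjS ψ) z := fun z =>
    mul_nonneg (by norm_num) (virialX_coercive hM φ _ z).1
  have hs : MeasurableSet {q : E2 × E2 | ‖q.1 - q.2‖ < 1 / M} :=
    (isOpen_lt (by fun_prop) continuous_const).measurableSet
  rw [← integral_const_mul]
  refine le_trans (integral_mono_of_nonneg (Eventually.of_forall fun z => by positivity)
    hX.integrableOn ?_) (setIntegral_le_integral hX (Eventually.of_forall hX0))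
  filter_upwards [ae_restrict_mem hs] with z hz
  have hz' : ∑ i, relC i z ^ 2 < (M⁻¹) ^ 2 := by
    have h : ‖z.1 - z.2‖ ^ 2 = ∑ i, relC i z ^ 2 := by
      simp [EuclideanSpace.norm_sq_eq, relC]
    rw [← h, inv_eq_one_div]
    exact pow_lt_pow_left₀ hz (norm_nonneg _) two_ne_zero
  refine le_trans (le_of_eq ?_)
    ((virialX_coercive hM φ (conjS ψ) z).2 hz')
  have hc : (fun z => conj (ψ z)) = ⇑(conjS ψ) := by ext; simp
  simp only [hc, pd_eq_lineDerivOp, lineDerivOp_diagV_tens_apply, conjS_apply]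
  refine congrArg (M * ·) (Finset.sum_congr rfl fun k _ => ?_)
  rw [add_comm, mul_comm (conj (ψ z.2))]

end VirialProof

/-- The localized bilinear virial estimate:
`∫₀ᵀ ∫∫_{|x−y|<1/M} M |u(t,x) ∇_y conj(v(t,y)) + conj(v(t,y)) ∇_x u(t,x)|² dxdydt
  ≤ C_T (‖v(0)‖²_{L²}‖u(0)‖_{L²}‖u(0)‖_{ℋ¹} + ‖u(0)‖²_{L²}‖v(0)‖_{L²}‖v(0)‖_{ℋ¹})`,
where `|·|` is the euclidean norm of a vector in `ℂ²`. -/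
theorem bilinear_virial (T : ℝ) (hT : 0 < T) :
    ∃ C : ℝ, 0 < C ∧ ∀ M : ℝ, 1 ≤ M →
      ∀ u v : ℝ → SchwartzMap E2 ℂ, IsLinSolution u → IsLinSolution v →
      (∫ t in (0:ℝ)..T, ∫ q in {q : E2 × E2 | ‖q.1 - q.2‖ < 1/M},
          M * ∑ k : Fin 2,
            ‖u t q.1 * pd k (fun z => (starRingEnd ℂ) (v t z)) q.2
              + (starRingEnd ℂ) (v t q.2) * pd k (fun z => u t z) q.1‖^2)
        ≤ C * (L2norm (fun z => v 0 z)^2 * L2norm (fun z => u 0 z)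
              * H1norm (fun z => u 0 z)
            + L2norm (fun z => u 0 z)^2 * L2norm (fun z => v 0 z)
              * H1norm (fun z => v 0 z)) := by
  refine ⟨6 + 6 * T, by positivity, fun M hM1 u v hu hv => ?_⟩
  have hM : 0 < M := by linarith
  change _ ≤ (6 + 6 * T) * bilin (u 0) (v 0)
  have hR := bilin_nonneg (u 0) (v 0)
  set g : ℝ → ℝ := fun t => ∫ q in {q : E2 × E2 | ‖q.1 - q.2‖ < 1/M},
    M * ∑ k : Fin 2, ‖u t q.1 * pd k (fun z => (starRingEnd ℂ) (v t z)) q.2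
      + (starRingEnd ℂ) (v t q.2) * pd k (fun z => u t z) q.1‖^2
  by_cases hg : IntervalIntegrable g volume 0 T
  · obtain ⟨hZ, hZle⟩ := hu.integral_virial_le hv hM hT.le
    have hconst : IntervalIntegrable (fun _ : ℝ => 2 * bilin (u 0) (v 0)) volume 0 T :=
      intervalIntegrable_const
    have hle := intervalIntegral.integral_mono_on hT.le hg ((hZ.add hconst).const_mul 3)
      (fun t _ => (setIntegral_le_virialX hM (u t) (v t)).trans (by
        have := integral_virialY_le hM (u t) (conjS (v t))
        rw [bilin_conjS, hu.bilin_eq hv t 0] at this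
        gcongr
        linarith))
    refine hle.trans ?_
    rw [intervalIntegral.integral_const_mul, intervalIntegral.integral_add hZ hconst,
      intervalIntegral.integral_const, smul_eq_mul, sub_zero]
    nlinarith
  · rw [intervalIntegral.integral_undef hg]
    positivity
end
end

section
/- There exist a constant C > 0 and λ₀ ≥ 1 such that for every Schwartz function φ : ℝ² → ℂ, every real λ ≥ λ₀, and every x ∈ ℝ², the following pointwise estimate holds: |φ(x)|² ≤ C λ⁻² ∫_{ {y : |x−y| < 1/λ} } |A φ(y)|² dy + C λ² ∫_{ {y : |x−y| < 1/λ} } |φ(y)|² dy. -/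
open MeasureTheory Complex

noncomputable section

theorem hasDerivAt_max_zero_sq (t : ℝ) :
    HasDerivAt (fun s : ℝ => max s 0 ^ 2) (2 * max t 0) t := by
  rcases lt_trichotomy t 0 with ht | rfl | ht
  · rw [max_eq_right ht.le, mul_zero]
    refine (hasDerivAt_const t (0 : ℝ)).congr_of_eventuallyEq ?_
    filter_upwards [eventually_lt_nhds ht] with s hs
    simp [max_eq_right hs.le]
  · rw [hasDerivAt_iff_isLittleO_nhds_zero]
    have h : (fun s : ℝ => s ^ 2) =o[nhds 0] fun s : ℝ => s := by
      simpa using Asymptotics.isLittleO_pow_pow (𝕜 := ℝ) (m := 1) (n := 2) (by norm_num)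
    refine Asymptotics.IsBigO.trans_isLittleO (Asymptotics.IsBigO.of_bound 1 ?_) h
    refine Filter.Eventually.of_forall fun s => ?_
    rcases le_total s 0 with hs | hs <;> simp [hs, sq_nonneg]
  · rw [max_eq_left ht.le]
    have h : HasDerivAt (fun s : ℝ => s ^ 2) (2 * t) t := by
      simpa using hasDerivAt_pow 2 t
    refine h.congr_of_eventuallyEq ?_
    filter_upwards [eventually_gt_nhds ht] with s hs
    simp [max_eq_left hs.le]

/-- A radial `C¹` cutoff supported in the closed unit disc. -/
def radialCutoff (y : E2) : ℝ := max (1 - ‖y‖ ^ 2) 0 ^ 2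

/-- The radial weight with `∇ radialCutoff y = -(radialWeight y) y`. -/
def radialWeight (y : E2) : ℝ := 4 * max (1 - ‖y‖ ^ 2) 0

theorem continuous_radialCutoff : Continuous radialCutoff := by
  unfold radialCutoff; fun_prop

theorem continuous_radialWeight : Continuous radialWeight := by
  unfold radialWeight; fun_prop

theorem radialCutoff_nonneg (y : E2) : 0 ≤ radialCutoff y := by
  unfold radialCutoff; positivity

theorem radialWeight_nonneg (y : E2) : 0 ≤ radialWeight y := by
  unfold radialWeight; positivity

theorem max_one_sub_norm_sq_eq_zero {y : E2} (hy : y ∉ Metric.ball (0 : E2) 1) :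
    max (1 - ‖y‖ ^ 2) 0 = 0 := by
  have h : 1 ≤ ‖y‖ := by simpa using hy
  exact max_eq_right (by nlinarith)

theorem radialCutoff_eq_zero {y : E2} (hy : y ∉ Metric.ball (0 : E2) 1) :
    radialCutoff y = 0 := by
  simp [radialCutoff, max_one_sub_norm_sq_eq_zero hy]

theorem radialWeight_eq_zero {y : E2} (hy : y ∉ Metric.ball (0 : E2) 1) :
    radialWeight y = 0 := by
  simp [radialWeight, max_one_sub_norm_sq_eq_zero hy]

theorem hasCompactSupport_radialCutoff : HasCompactSupport radialCutoff :=
  HasCompactSupport.intro (isCompact_closedBall 0 1) fun _ hy =>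
    radialCutoff_eq_zero fun h => hy (Metric.ball_subset_closedBall h)

theorem hasCompactSupport_radialWeight : HasCompactSupport radialWeight :=
  HasCompactSupport.intro (isCompact_closedBall 0 1) fun _ hy =>
    radialWeight_eq_zero fun h => hy (Metric.ball_subset_closedBall h)

theorem hasFDerivAt_radialCutoff (y : E2) :
    HasFDerivAt radialCutoff (-radialWeight y • innerSL ℝ y) y := by
  have h := (hasDerivAt_max_zero_sq (1 - ‖y‖ ^ 2)).comp_hasFDerivAt y
    ((hasStrictFDerivAt_norm_sq y).hasFDerivAt.const_sub 1)
  have he : (2 * max (1 - ‖y‖ ^ 2) 0) • -(2 • innerSL ℝ y) = -radialWeight y • innerSL ℝ y := by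
    ext v
    simp [radialWeight]
    ring
  exact he ▸ h

theorem fderiv_radialCutoff_single (i : Fin 2) (y : E2) :
    fderiv ℝ radialCutoff y (EuclideanSpace.single i 1) = -(y i * radialWeight y) := by
  rw [(hasFDerivAt_radialCutoff y).fderiv]
  have h : inner ℝ y (EuclideanSpace.single i 1) = y i := by
    simpa using EuclideanSpace.inner_single_right i (1 : ℝ) y
  simp [h, mul_comm]

theorem integral_radialWeight_pos : 0 < ∫ y, radialWeight y :=
  continuous_radialWeight.integral_pos_of_hasCompactSupport_nonneg_nonzero
    hasCompactSupport_radialWeight radialWeight_nonneg (x := 0) (by simp [radialWeight])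

/-- Cauchy–Schwarz for the Bochner integral of real functions. -/
theorem integral_mul_le_sqrt_mul_sqrt {α : Type*} [MeasurableSpace α] {μ : Measure α}
    {f g : α → ℝ} (hf : MemLp f 2 μ) (hg : MemLp g 2 μ) :
    ∫ a, |f a| * |g a| ∂μ ≤ √(∫ a, f a ^ 2 ∂μ) * √(∫ a, g a ^ 2 ∂μ) := by
  have h := integral_mul_norm_le_Lp_mul_Lq (μ := μ) (f := f) (g := g) Real.HolderConjugate.two_two
    (by simpa using hf) (by simpa using hg)
  simpa [Real.sqrt_eq_rpow] using h

theorem memLp_restrict_ball {f : E2 → ℝ} (hf : Continuous f) (x : E2) (r : ℝ) :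
    MemLp f 2 (volume.restrict (Metric.ball x r)) := by
  obtain ⟨K, hK⟩ := (isCompact_closedBall x r).exists_bound_of_continuousOn hf.continuousOn
  have : IsFiniteMeasure (volume.restrict (Metric.ball x r)) :=
    isFiniteMeasure_restrict.2 measure_ball_lt_top.ne
  refine MemLp.of_bound hf.aestronglyMeasurable K ?_
  exact (ae_restrict_mem measurableSet_ball).mono fun y hy => hK y (Metric.ball_subset_closedBall hy)

theorem setIntegral_ball_dilation (f : E2 → ℝ) (x : E2) {s : ℝ} (hs : 0 < s) :
    ∫ y in Metric.ball (0 : E2) 1, f (x + s • y) = (s ^ 2)⁻¹ * ∫ y in Metric.ball x s, f y := by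
  rw [Measure.setIntegral_comp_smul_of_pos volume (fun y => f (x + y)) _ hs,
    smul_unitBall_of_pos hs]
  have h := (measurePreserving_add_left (volume : Measure E2) x).setIntegral_preimage_emb
    (measurableEmbedding_addLeft x) f (Metric.ball x s)
  simp only [preimage_add_ball, sub_self] at h
  simp [h]

theorem setIntegral_dilation_mul_le {f k : E2 → ℝ} (hf : Continuous f) (hk : Continuous k)
    (x : E2) {s : ℝ} (hs : 0 < s) :
    s * ∫ y in Metric.ball (0 : E2) 1, |f (x + s • y)| * |k y| ≤
      √(∫ y in Metric.ball x s, f y ^ 2) * √(∫ y in Metric.ball (0 : E2) 1, k y ^ 2) := by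
  have h := integral_mul_le_sqrt_mul_sqrt
    (memLp_restrict_ball (hf.comp (by fun_prop : Continuous fun y : E2 => x + s • y)) 0 1)
    (memLp_restrict_ball hk 0 1)
  simp only [Function.comp_apply] at h
  rw [setIntegral_ball_dilation (fun y => f y ^ 2) x hs, Real.sqrt_mul (by positivity),
    Real.sqrt_inv, Real.sqrt_sq hs.le, mul_assoc] at h
  calc _ ≤ _ := mul_le_mul_of_nonneg_left h hs.le
    _ = _ := by field_simp

theorem hasDerivAt_integral_dilation_mul {w k : E2 → ℝ} (hw : ContDiff ℝ 1 w) (hk : Continuous k)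
    (hkc : HasCompactSupport k) (x : E2) (s : ℝ) :
    HasDerivAt (fun t : ℝ => ∫ y, w (x + t • y) * k y)
      (∫ y, fderiv ℝ w (x + s • y) y * k y) s := by
  have hw' : Continuous (fderiv ℝ w) := hw.continuous_fderiv one_ne_zero
  have hwc := hw.continuous
  have hcont : Continuous fun p : ℝ × E2 => fderiv ℝ w (x + p.1 • p.2) p.2 :=
    (hw'.comp (by fun_prop : Continuous fun p : ℝ × E2 => x + p.1 • p.2)).clm_apply continuous_snd
  obtain ⟨K, hK⟩ := ((isCompact_closedBall s 1).prod hkc.isCompact).exists_bound_of_continuousOn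
    hcont.continuousOn
  refine (hasDerivAt_integral_of_dominated_loc_of_deriv_le (μ := volume)
    (F' := fun t y => fderiv ℝ w (x + t • y) y * k y) (bound := fun y => K * |k y|)
    (Metric.closedBall_mem_nhds s one_pos) ?_ ?_ ?_ ?_ ?_ ?_).2
  · exact Filter.Eventually.of_forall fun t => by fun_prop
  · exact Continuous.integrable_of_hasCompactSupport (by fun_prop) hkc.mul_left
  · exact ((hcont.comp (by fun_prop : Continuous fun y : E2 => (s, y))).mul hk).aestronglyMeasurable
  · refine Filter.Eventually.of_forall fun y t ht => ?_
    by_cases hy : y ∈ tsupport k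
    · rw [norm_mul, Real.norm_eq_abs (k y)]
      exact mul_le_mul_of_nonneg_right (hK (t, y) ⟨ht, hy⟩) (abs_nonneg _)
    · simp [image_eq_zero_of_notMem_tsupport hy]
  · exact (continuous_const.mul hk.abs).integrable_of_hasCompactSupport (hkc.abs.mul_left)
  · refine Filter.Eventually.of_forall fun y t _ => ?_
    have h1 : HasDerivAt (fun t : ℝ => x + t • y) y t := by
      simpa using ((hasDerivAt_id t).smul_const y).const_add x
    exact ((hw.differentiable one_ne_zero _).hasFDerivAt.comp_hasDerivAt t h1).mul_const _

theorem contDiff_pdR {w : E2 → ℝ} {n : WithTop ℕ∞} (hw : ContDiff ℝ (n + 1) w) (i : Fin 2) :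
    ContDiff ℝ n (pdR i w) :=
  (hw.fderiv_right le_rfl).clm_apply contDiff_const

theorem integral_fderiv_dilation_mul_radialWeight {w : E2 → ℝ} (hw : ContDiff ℝ 2 w) (x : E2)
    (s : ℝ) :
    ∫ y, fderiv ℝ w (x + s • y) y * radialWeight y =
      s * ∫ y, lapR w (x + s • y) * radialCutoff y := by
  have hp (i : Fin 2) : ContDiff ℝ 1 (pdR i w) := contDiff_pdR (n := 1) hw i
  have hpc (i : Fin 2) : Continuous (pdR i w) := (hp i).continuous
  have hpp (i : Fin 2) : Continuous (pdR i (pdR i w)) :=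
    (contDiff_pdR (n := 0) (by simpa using hp i) i).continuous
  have hη := continuous_radialWeight
  have hΨ := continuous_radialCutoff
  have hd (i : Fin 2) (y : E2) : fderiv ℝ (fun y => pdR i w (x + s • y)) y
      (EuclideanSpace.single i 1) = s * pdR i (pdR i w) (x + s • y) := by
    have h1 : HasFDerivAt (fun y : E2 => x + s • y) (s • ContinuousLinearMap.id ℝ E2) y :=
      ((hasFDerivAt_id y).const_smul s).const_add x
    have h2 := (((hp i).differentiable one_ne_zero (x + s • y)).hasFDerivAt.comp y h1).fderiv
    rw [Function.comp_def] at h2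
    rw [h2]
    simp [pdR]
  have hparts (i : Fin 2) : ∫ y : E2, pdR i w (x + s • y) * (y i * radialWeight y) =
      ∫ y, s * (pdR i (pdR i w) (x + s • y) * radialCutoff y) := by
    have h := integral_mul_fderiv_eq_neg_fderiv_mul_of_integrable (μ := volume)
      (f := fun y => pdR i w (x + s • y)) (g := radialCutoff) (v := EuclideanSpace.single i 1)
      ?_ ?_ ?_ ?_ ?_
    · simp only [hd, fderiv_radialCutoff_single, mul_neg, integral_neg, neg_inj, mul_assoc] at h
      exact h
    · simp only [hd]
      exact Continuous.integrable_of_hasCompactSupport (by fun_prop)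
        hasCompactSupport_radialCutoff.mul_left
    · simp only [fderiv_radialCutoff_single]
      exact Continuous.integrable_of_hasCompactSupport (by fun_prop)
        hasCompactSupport_radialWeight.mul_left.neg.mul_left
    · exact Continuous.integrable_of_hasCompactSupport (by fun_prop)
        hasCompactSupport_radialCutoff.mul_left
    · exact fun y _ => ((hp i).differentiable one_ne_zero).comp (by fun_prop) y
    · exact fun y _ => (hasFDerivAt_radialCutoff y).differentiableAt
  have hexp (y : E2) : fderiv ℝ w (x + s • y) y * radialWeight y =
      ∑ i : Fin 2, pdR i w (x + s • y) * (y i * radialWeight y) := by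
    have hy : y = ∑ i : Fin 2, y i • EuclideanSpace.single i (1 : ℝ) := by
      ext j; fin_cases j <;> simp
    conv_lhs => enter [1, 2]; rw [hy]
    simp only [map_sum, map_smul, Finset.sum_mul, pdR, smul_eq_mul]
    exact Finset.sum_congr rfl fun i _ => by ring
  simp only [hexp, lapR, Finset.sum_mul]
  rw [integral_finsetSum, integral_finsetSum, Finset.mul_sum]
  · exact Finset.sum_congr rfl fun i _ => by rw [hparts, integral_const_mul]
  · exact fun i _ => Continuous.integrable_of_hasCompactSupport (by fun_prop)
      hasCompactSupport_radialCutoff.mul_left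
  · exact fun i _ => Continuous.integrable_of_hasCompactSupport (by fun_prop)
      hasCompactSupport_radialWeight.mul_left.mul_left

/-- A local mean-value inequality for `C²` functions whose Laplacian is bounded below by `-g`,
with the source term measured in `L²`. -/
theorem mul_integral_radialWeight_le {w g : E2 → ℝ} (hw : ContDiff ℝ 2 w) (hg : Continuous g)
    (hsub : ∀ y, -|g y| ≤ lapR w y) (x : E2) {r : ℝ} (hr : 0 < r) :
    w x * ∫ y, radialWeight y ≤ (∫ y, w (x + r • y) * radialWeight y) +
      r * (√(∫ y in Metric.ball x r, g y ^ 2) *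
        √(∫ y in Metric.ball (0 : E2) 1, radialCutoff y ^ 2)) := by
  have hΨ := continuous_radialCutoff
  have hlap : Continuous (lapR w) := continuous_finsetSum _ fun i _ =>
    (contDiff_pdR (n := 0) (by simpa using contDiff_pdR (n := 1) hw i) i).continuous
  have hderiv (s : ℝ) := hasDerivAt_integral_dilation_mul (hw.of_le one_le_two)
    continuous_radialWeight hasCompactSupport_radialWeight x s
  have hbound : ∀ s ∈ interior (Set.Icc 0 r),
      -(√(∫ y in Metric.ball x r, g y ^ 2) *
        √(∫ y in Metric.ball (0 : E2) 1, radialCutoff y ^ 2)) ≤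
      deriv (fun t : ℝ => ∫ y, w (x + t • y) * radialWeight y) s := by
    intro s hs
    rw [interior_Icc] at hs
    rw [(hderiv s).deriv, integral_fderiv_dilation_mul_radialWeight hw]
    have h1 : -∫ y, |g (x + s • y)| * |radialCutoff y| ≤
        ∫ y, lapR w (x + s • y) * radialCutoff y := by
      rw [← integral_neg]
      refine integral_mono ?_ ?_ fun y => ?_
      · exact Continuous.integrable_of_hasCompactSupport (by fun_prop)
          hasCompactSupport_radialCutoff.abs.mul_left.neg
      · exact Continuous.integrable_of_hasCompactSupport (by fun_prop)
          hasCompactSupport_radialCutoff.mul_left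
      · simp only [abs_of_nonneg (radialCutoff_nonneg y), ← neg_mul]
        exact mul_le_mul_of_nonneg_right (hsub _) (radialCutoff_nonneg y)
    have h2 : ∫ y in Metric.ball (0 : E2) 1, |g (x + s • y)| * |radialCutoff y| =
        ∫ y, |g (x + s • y)| * |radialCutoff y| :=
      setIntegral_eq_integral_of_forall_compl_eq_zero fun y hy => by simp [radialCutoff_eq_zero hy]
    have h3 := setIntegral_dilation_mul_le hg hΨ x hs.1
    have h4 : ∫ y in Metric.ball x s, g y ^ 2 ≤ ∫ y in Metric.ball x r, g y ^ 2 :=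
      setIntegral_mono_set (memLp_restrict_ball hg x r).integrable_sq
        (Filter.Eventually.of_forall fun _ => sq_nonneg _)
        (Metric.ball_subset_ball hs.2.le).eventuallyLE
    have h5 := h3.trans (mul_le_mul_of_nonneg_right (Real.sqrt_le_sqrt h4) (Real.sqrt_nonneg _))
    have h6 := mul_le_mul_of_nonneg_left h1 hs.1.le
    rw [h2] at h5
    linarith
  have hmv := (convex_Icc 0 r).mul_sub_le_image_sub_of_le_deriv
    (fun s _ => (hderiv s).continuousAt.continuousWithinAt)
    (fun s _ => (hderiv s).differentiableAt.differentiableWithinAt) hbound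
    0 ⟨le_rfl, hr.le⟩ r ⟨hr.le, le_rfl⟩ hr.le
  simp only [zero_smul, add_zero, sub_zero, integral_const_mul] at hmv
  linarith

/-- A smooth approximation of `‖φ‖`. -/
def regNorm (ε : ℝ) (φ : E2 → ℂ) (y : E2) : ℝ := √(‖φ y‖ ^ 2 + ε ^ 2)

theorem regNorm_pos {ε : ℝ} (hε : 0 < ε) (φ : E2 → ℂ) (y : E2) : 0 < regNorm ε φ y :=
  Real.sqrt_pos.2 (by positivity)

theorem norm_le_regNorm (ε : ℝ) (φ : E2 → ℂ) (y : E2) : ‖φ y‖ ≤ regNorm ε φ y :=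
  Real.le_sqrt_of_sq_le (by nlinarith [sq_nonneg ε])

theorem regNorm_le {ε : ℝ} (hε : 0 < ε) (φ : E2 → ℂ) (y : E2) : regNorm ε φ y ≤ ‖φ y‖ + ε :=
  Real.sqrt_le_iff.2 ⟨by positivity, by nlinarith [norm_nonneg (φ y)]⟩

theorem contDiff_regNorm {ε : ℝ} (hε : 0 < ε) {φ : E2 → ℂ} {n : WithTop ℕ∞} (hφ : ContDiff ℝ n φ) :
    ContDiff ℝ n (regNorm ε φ) :=
  ((hφ.norm_sq ℝ).add contDiff_const).sqrt fun y => by positivity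

theorem pdR_regNorm {ε : ℝ} (hε : 0 < ε) {φ : E2 → ℂ} (hφ : Differentiable ℝ φ) (i : Fin 2)
    (y : E2) : pdR i (regNorm ε φ) y = inner ℝ (φ y) (pd i φ y) / regNorm ε φ y := by
  have h := (((hφ y).hasFDerivAt.norm_sq.add_const (ε ^ 2)).sqrt (by positivity)).fderiv
  unfold pdR
  rw [show regNorm ε φ = fun y => √(‖φ y‖ ^ 2 + ε ^ 2) from rfl, h]
  simp [pd]
  field_simp

theorem inner_pd_pd_div_le {ε : ℝ} (hε : 0 < ε) {φ : E2 → ℂ} (hφ : ContDiff ℝ 2 φ) (i : Fin 2)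
    (y : E2) :
    inner ℝ (φ y) (pd i (pd i φ) y) / regNorm ε φ y ≤ pdR i (pdR i (regNorm ε φ)) y := by
  have hφ1 : Differentiable ℝ φ := hφ.differentiable two_ne_zero
  have hpd : Differentiable ℝ (pd i φ) :=
    ((hφ.fderiv_right (m := 1) le_rfl).clm_apply contDiff_const).differentiable one_ne_zero
  have hw : Differentiable ℝ (regNorm ε φ) := (contDiff_regNorm hε hφ).differentiable two_ne_zero
  have hpos := regNorm_pos hε φ y
  have heq : pdR i (pdR i (regNorm ε φ)) y =
      (inner ℝ (φ y) (pd i (pd i φ) y) + ‖pd i φ y‖ ^ 2) / regNorm ε φ y -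
        inner ℝ (φ y) (pd i φ y) ^ 2 / regNorm ε φ y ^ 3 := by
    have h := (((hφ1 y).hasFDerivAt.inner ℝ (hpd y).hasFDerivAt).mul
      ((hasDerivAt_inv hpos.ne').comp_hasFDerivAt y (hw y).hasFDerivAt)).fderiv
    have hp := pdR_regNorm hε hφ1 i y
    rw [show pdR i (regNorm ε φ) = fun x => inner ℝ (φ x) (pd i φ x) * (regNorm ε φ x)⁻¹ from
      funext fun x => (pdR_regNorm hε hφ1 i x).trans (div_eq_mul_inv _ _)]
    unfold pdR at hp ⊢
    have h' := congrArg (fun L => L (EuclideanSpace.single i 1)) h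
    simp only [Function.comp_def] at h'
    refine h'.trans ?_
    have hd (f : E2 → ℂ) : fderiv ℝ f y (EuclideanSpace.single i 1) = pd i f y := rfl
    simp [hp, hd, fderivInnerCLM_apply, Complex.sq_norm, Complex.normSq_apply]
    field_simp
    ring
  have hcs : inner ℝ (φ y) (pd i φ y) ^ 2 ≤ ‖pd i φ y‖ ^ 2 * regNorm ε φ y ^ 2 := by
    rw [← mul_pow, ← sq_abs]
    refine pow_le_pow_left₀ (abs_nonneg _) ((abs_real_inner_le_norm _ _).trans ?_) 2
    rw [mul_comm]
    exact mul_le_mul_of_nonneg_left (norm_le_regNorm _ _ _) (norm_nonneg _)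
  have hcs' : inner ℝ (φ y) (pd i φ y) ^ 2 / regNorm ε φ y ^ 3 ≤
      ‖pd i φ y‖ ^ 2 / regNorm ε φ y := by
    rw [div_le_div_iff₀ (by positivity) hpos]
    nlinarith
  rw [heq, add_div]
  linarith

/-- A regularized Kato inequality for the harmonic oscillator. -/
theorem neg_norm_Aop_le_lapR_regNorm {ε : ℝ} (hε : 0 < ε) {φ : E2 → ℂ} (hφ : ContDiff ℝ 2 φ)
    (y : E2) : -‖Aop φ y‖ ≤ lapR (regNorm ε φ) y := by
  have hpos := regNorm_pos hε φ y
  have hlap : lap φ y = ‖y‖ ^ 2 • φ y - Aop φ y := by simp [Aop]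
  calc -‖Aop φ y‖ ≤ inner ℝ (φ y) (lap φ y) / regNorm ε φ y := by
        rw [le_div_iff₀ hpos, hlap, inner_sub_right, inner_smul_right, real_inner_self_eq_norm_sq]
        have h1 := (real_inner_le_norm (φ y) (Aop φ y)).trans
          (mul_le_mul_of_nonneg_right (norm_le_regNorm ε φ y) (norm_nonneg _))
        have h2 : 0 ≤ ‖y‖ ^ 2 * ‖φ y‖ ^ 2 := by positivity
        linarith
    _ = ∑ i : Fin 2, inner ℝ (φ y) (pd i (pd i φ) y) / regNorm ε φ y := by
        rw [lap, inner_sum, Finset.sum_div]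
    _ ≤ _ := Finset.sum_le_sum fun i _ => inner_pd_pd_div_le hε hφ i y

theorem continuous_Aop {φ : E2 → ℂ} (hφ : ContDiff ℝ 2 φ) : Continuous (Aop φ) := by
  have hpd (i : Fin 2) : ContDiff ℝ 1 (pd i φ) :=
    (hφ.fderiv_right (m := 1) le_rfl).clm_apply contDiff_const
  have hpd2 (i : Fin 2) : Continuous (pd i (pd i φ)) :=
    ((hpd i).continuous_fderiv one_ne_zero).clm_apply continuous_const
  have hc := hφ.continuous
  unfold Aop lap
  fun_prop

theorem norm_mul_integral_radialWeight_le {φ : E2 → ℂ} (hφ : ContDiff ℝ 2 φ) (x : E2) {r : ℝ}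
    (hr : 0 < r) :
    ‖φ x‖ * ∫ y, radialWeight y ≤
      r⁻¹ * (√(∫ y in Metric.ball x r, ‖φ y‖ ^ 2) *
        √(∫ y in Metric.ball (0 : E2) 1, radialWeight y ^ 2)) +
      r * (√(∫ y in Metric.ball x r, ‖Aop φ y‖ ^ 2) *
        √(∫ y in Metric.ball (0 : E2) 1, radialCutoff y ^ 2)) := by
  have hφc := hφ.continuous
  have hη := continuous_radialWeight
  have hint {u : E2 → ℝ} (hu : Continuous u) : Integrable fun y => u y * radialWeight y :=
    Continuous.integrable_of_hasCompactSupport (by fun_prop) hasCompactSupport_radialWeight.mul_left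
  have hIpos := integral_radialWeight_pos
  have h1 : (∫ y, ‖φ (x + r • y)‖ * radialWeight y) ≤
      r⁻¹ * (√(∫ y in Metric.ball x r, ‖φ y‖ ^ 2) *
        √(∫ y in Metric.ball (0 : E2) 1, radialWeight y ^ 2)) := by
    have h := setIntegral_dilation_mul_le hφc.norm hη x hr
    rw [setIntegral_eq_integral_of_forall_compl_eq_zero fun y hy => by
      simp [radialWeight_eq_zero hy]] at h
    simp only [abs_norm, abs_of_nonneg (radialWeight_nonneg _)] at h
    rwa [← div_eq_inv_mul, le_div_iff₀' hr]
  refine le_of_forall_pos_le_add fun δ hδ => ?_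
  have hε : 0 < δ / ∫ y, radialWeight y := by positivity
  set ε := δ / ∫ y, radialWeight y with hεdef
  have hw := contDiff_regNorm hε hφ
  have hwc := hw.continuous
  have h2 := mul_integral_radialWeight_le hw (continuous_Aop hφ).norm
    (fun y => by simpa using neg_norm_Aop_le_lapR_regNorm hε hφ y) x hr
  have h3 : (∫ y, regNorm ε φ (x + r • y) * radialWeight y) ≤
      (∫ y, ‖φ (x + r • y)‖ * radialWeight y) + δ := by
    calc _ ≤ ∫ y, (‖φ (x + r • y)‖ + ε) * radialWeight y :=
          integral_mono (hint (by fun_prop)) (hint (by fun_prop)) fun y =>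
            mul_le_mul_of_nonneg_right (regNorm_le hε φ _) (radialWeight_nonneg y)
      _ = _ := by
          simp only [add_mul]
          rw [integral_add (hint (by fun_prop)) (hint (by fun_prop)), integral_const_mul, hεdef,
            div_mul_cancel₀ _ hIpos.ne']
  have h4 := mul_le_mul_of_nonneg_right (norm_le_regNorm ε φ x) hIpos.le
  linarith

/-- Local elliptic pointwise estimate for the harmonic oscillator:
`|φ(x)|² ≤ C λ⁻² ∫_{|x−y|<1/λ} |Aφ|² + C λ² ∫_{|x−y|<1/λ} |φ|²`. -/
theorem local_elliptic_estimate :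
    ∃ C : ℝ, 0 < C ∧ ∃ lam0 : ℝ, 1 ≤ lam0 ∧
      ∀ (φ : SchwartzMap E2 ℂ) (lam : ℝ), lam0 ≤ lam → ∀ x : E2,
        ‖φ x‖^2 ≤ C / lam^2 * (∫ y in Metric.ball x (1/lam), ‖Aop (fun z => φ z) y‖^2)
          + C * lam^2 * ∫ y in Metric.ball x (1/lam), ‖φ y‖^2 := by
  have hI := integral_radialWeight_pos
  set I := ∫ y, radialWeight y
  set N := ∫ y in Metric.ball (0 : E2) 1, radialWeight y ^ 2 with hN
  set M := ∫ y in Metric.ball (0 : E2) 1, radialCutoff y ^ 2 with hM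
  have hN0 : 0 ≤ N := integral_nonneg fun y => sq_nonneg _
  have hM0 : 0 ≤ M := integral_nonneg fun y => sq_nonneg _
  refine ⟨2 * (N + M + 1) / I ^ 2, by positivity, 1, le_rfl, fun φ lam hlam x => ?_⟩
  have hlam0 : 0 < lam := one_pos.trans_le hlam
  have h := norm_mul_integral_radialWeight_le (φ := fun z => φ z) (φ.smooth 2) x
    (one_div_pos.2 hlam0)
  rw [← hN, ← hM] at h
  set P := ∫ y in Metric.ball x (1 / lam), ‖φ y‖ ^ 2
  set F := ∫ y in Metric.ball x (1 / lam), ‖Aop (fun z => φ z) y‖ ^ 2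
  have hP0 : 0 ≤ P := integral_nonneg fun y => sq_nonneg _
  have hF0 : 0 ≤ F := integral_nonneg fun y => sq_nonneg _
  have h1 : ‖φ x‖ ^ 2 * I ^ 2 ≤ 2 * (lam ^ 2 * (P * N) + (lam ^ 2)⁻¹ * (F * M)) := by
    rw [← mul_pow]
    refine (pow_le_pow_left₀ (by positivity) h 2).trans (add_sq_le.trans_eq ?_)
    simp only [mul_pow, Real.sq_sqrt hP0, Real.sq_sqrt hN0, Real.sq_sqrt hF0, Real.sq_sqrt hM0,
      one_div, inv_inv, inv_pow]
  have h2 : lam ^ 2 * (P * N) ≤ lam ^ 2 * (P * (N + M + 1)) := by gcongr; linarith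
  have h3 : (lam ^ 2)⁻¹ * (F * M) ≤ (lam ^ 2)⁻¹ * (F * (N + M + 1)) := by gcongr; linarith
  have h4 : ‖φ x‖ ^ 2 ≤
      2 * (lam ^ 2 * (P * (N + M + 1)) + (lam ^ 2)⁻¹ * (F * (N + M + 1))) / I ^ 2 := by
    rw [le_div_iff₀ (by positivity)]
    linarith
  refine h4.trans_eq ?_
  field_simp
  ring
end
end
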